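/- arXiv:2604.14255 — 8 statements merged into one kernel-verified Lean document; each statement's English description precedes it below -/
import Mathlib

section
/- Let L be a countable linear order. Then L is C_{∞,∞}-homogeneous if and only if L is sp-homogeneous. -/
/- `sFun x` is the successor of `x` if it exists, and `x` otherwise. -/
open Classical in
noncomputable def sFun {L : Type*} [LinearOrder L] (x : L) : L :=
  if h : ∃ y, x ⋖ y then h.choose else x

/- `pFun x` is the predecessor of `x` if it exists, and `x` otherwise. -/
open Classical in
noncomputable def pFun {L : Type*} [LinearOrder L] (x : L) : L :=
  if h : ∃ y, y ⋖ x then h.choose else x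

/-- The closure of a set under the successor and predecessor functions. -/
def spClosure (L : Type*) [LinearOrder L] (A : Set L) : Set L :=
  ⋂₀ {B : Set L | A ⊆ B ∧ ∀ x ∈ B, sFun x ∈ B ∧ pFun x ∈ B}

/-- A linear order is sp-homogeneous if every order-preserving, `s`- and `p`-commuting
bijection between the sp-closures of two finite tuples that sends one tuple to the other
extends to an order-automorphism commuting with `s` and `p` and sending the one tuple
to the other. -/
def IsSPHomogeneous (L : Type*) [LinearOrder L] : Prop :=
  ∀ (n : ℕ) (a b : Fin n → L),
    (∃ g : L → L,
      Set.BijOn g (spClosure L (Set.range a)) (spClosure L (Set.range b)) ∧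
      (∀ x ∈ spClosure L (Set.range a), ∀ y ∈ spClosure L (Set.range a),
        (x < y ↔ g x < g y)) ∧
      (∀ x ∈ spClosure L (Set.range a), g (sFun x) = sFun (g x)) ∧
      (∀ x ∈ spClosure L (Set.range a), g (pFun x) = pFun (g x)) ∧
      (∀ i, g (a i) = b i)) →
    ∃ σ : L ≃o L, (∀ x, σ (sFun x) = sFun (σ x)) ∧ (∀ x, σ (pFun x) = pFun (σ x)) ∧
      ∀ i, σ (a i) = b i

/-- `HasSuccChain i x` : there is a chain `x = x₀ ⋖ x₁ ⋖ ⋯ ⋖ xᵢ` (x has at least `i`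
successors); this is the relation `S_i`. -/
def HasSuccChain {L : Type*} [LinearOrder L] : ℕ → L → Prop
  | 0, _ => True
  | (i+1), x => ∃ y, x ⋖ y ∧ HasSuccChain i y

/-- `HasPredChain i x` : there is a chain `xᵢ ⋖ ⋯ ⋖ x₁ ⋖ x₀ = x` (x has at least `i`
predecessors); this is the relation `P_i`. -/
def HasPredChain {L : Type*} [LinearOrder L] : ℕ → L → Prop
  | 0, _ => True
  | (i+1), x => ∃ y, y ⋖ x ∧ HasPredChain i y

/-- `AdjRel k x y` : `x < y` and exactly `k` elements lie strictly between them. -/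
def AdjRel {L : Type*} [LinearOrder L] (k : ℕ) (x y : L) : Prop :=
  x < y ∧ (Set.Ioo x y).Finite ∧ (Set.Ioo x y).ncard = k

/-- `L` is `C_{n,m}`-homogeneous: every bijection between two finite subsets of `L`
preserving (in both directions) the order, the relations `S_i` for `i < n`, `P_j` for
`j < m`, and `Adj_k` for `k < n + m` extends to an order-automorphism of `L`. -/
def CnmHomogeneous (n m : ℕ∞) (L : Type*) [LinearOrder L] : Prop :=
  ∀ (A : Finset L) (g : L → L), Set.InjOn g ↑A →
    (∀ x ∈ A, ∀ y ∈ A, (x < y ↔ g x < g y)) →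
    (∀ i : ℕ, (i : ℕ∞) < n → ∀ x ∈ A, (HasSuccChain i x ↔ HasSuccChain i (g x))) →
    (∀ j : ℕ, (j : ℕ∞) < m → ∀ x ∈ A, (HasPredChain j x ↔ HasPredChain j (g x))) →
    (∀ k : ℕ, (k : ℕ∞) < n + m → ∀ x ∈ A, ∀ y ∈ A,
      (AdjRel k x y ↔ AdjRel k (g x) (g y))) →
    ∃ σ : L ≃o L, ∀ x ∈ A, σ x = g x

section SuccPred

variable {L : Type*} [LinearOrder L]

theorem CovBy.sFun_eq {x y : L} (h : x ⋖ y) : sFun x = y := by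
  have h' : ∃ y, x ⋖ y := ⟨y, h⟩
  rw [sFun, dif_pos h']
  exact h'.choose_spec.unique_right h

theorem CovBy.pFun_eq {x y : L} (h : y ⋖ x) : pFun x = y := by
  have h' : ∃ y, y ⋖ x := ⟨y, h⟩
  rw [pFun, dif_pos h']
  exact h'.choose_spec.unique_left h

theorem sFun_eq_self {x : L} (h : ¬∃ y, x ⋖ y) : sFun x = x := by
  rw [sFun, dif_neg h]

theorem pFun_eq_self {x : L} (h : ¬∃ y, y ⋖ x) : pFun x = x := by
  rw [pFun, dif_neg h]

theorem exists_covBy_iff_sFun_ne {x : L} : (∃ y, x ⋖ y) ↔ sFun x ≠ x := by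
  refine ⟨?_, fun h => by_contra fun h' => h (sFun_eq_self h')⟩
  rintro ⟨y, hy⟩
  rw [hy.sFun_eq]
  exact hy.lt.ne'

theorem sFun_toDual (x : L) : sFun (OrderDual.toDual x) = OrderDual.toDual (pFun x) := by
  by_cases h : ∃ y, y ⋖ x
  · obtain ⟨y, hy⟩ := h
    rw [hy.pFun_eq, hy.toDual.sFun_eq]
  · rw [pFun_eq_self h, sFun_eq_self]
    rintro ⟨y, hy⟩
    exact h ⟨OrderDual.ofDual y, hy.ofDual⟩

theorem hasSuccChain_toDual (i : ℕ) (x : L) :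
    HasSuccChain i (OrderDual.toDual x) ↔ HasPredChain i x := by
  induction i generalizing x with
  | zero => exact Iff.rfl
  | succ i ih =>
    constructor
    · rintro ⟨y, hy, h⟩
      exact ⟨OrderDual.ofDual y, hy.ofDual, (ih _).1 h⟩
    · rintro ⟨y, hy, h⟩
      exact ⟨OrderDual.toDual y, hy.toDual, (ih _).2 h⟩

theorem hasPredChain_toDual (i : ℕ) (x : L) :
    HasPredChain i (OrderDual.toDual x) ↔ HasSuccChain i x :=
  (hasSuccChain_toDual i (OrderDual.toDual x)).symm

theorem adjRel_toDual (k : ℕ) (x y : L) :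
    AdjRel k (OrderDual.toDual x) (OrderDual.toDual y) ↔ AdjRel k y x := by
  unfold AdjRel
  rw [Set.Ioo_toDual]
  exact Iff.rfl

theorem CovBy.hasSuccChain_succ {x y : L} (h : x ⋖ y) (i : ℕ) :
    HasSuccChain (i + 1) x ↔ HasSuccChain i y := by
  refine ⟨?_, fun hy => ⟨y, h, hy⟩⟩
  rintro ⟨z, hz, hi⟩
  rwa [h.unique_right hz]

theorem CovBy.hasPredChain_succ {x y : L} (h : x ⋖ y) (i : ℕ) :
    HasPredChain (i + 1) y ↔ HasPredChain i x := by
  refine ⟨?_, fun hx => ⟨x, h, hx⟩⟩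
  rintro ⟨z, hz, hi⟩
  rwa [h.unique_left hz]

theorem adjRel_zero {x y : L} : AdjRel 0 x y ↔ x ⋖ y := by
  rw [covBy_iff_Ioo_eq, AdjRel]
  constructor
  · rintro ⟨h, hf, hc⟩
    exact ⟨h, (Set.ncard_eq_zero hf).1 hc⟩
  · rintro ⟨h, he⟩
    simp [h, he]

theorem CovBy.Ioo_eq_insert {x z y : L} (h : x ⋖ z) (hzy : z < y) :
    Set.Ioo x y = insert z (Set.Ioo z y) := by
  ext t
  simp only [Set.mem_Ioo, Set.mem_insert_iff]
  constructor
  · rintro ⟨hxt, hty⟩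
    rcases (h.ge_of_gt hxt).eq_or_lt with e | e
    · exact Or.inl e.symm
    · exact Or.inr ⟨e, hty⟩
  · rintro (rfl | ⟨hzt, hty⟩)
    · exact ⟨h.lt, hzy⟩
    · exact ⟨h.lt.trans hzt, hty⟩

theorem CovBy.adjRel_succ {x z : L} (h : x ⋖ z) (k : ℕ) (y : L) :
    AdjRel (k + 1) x y ↔ AdjRel k z y := by
  rcases lt_or_ge z y with hzy | hyz
  · unfold AdjRel
    rw [h.Ioo_eq_insert hzy, Set.finite_insert]
    have hz : z ∉ Set.Ioo z y := fun hm => lt_irrefl _ hm.1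
    constructor
    · rintro ⟨-, hf, hc⟩
      rw [Set.ncard_insert_of_notMem hz hf] at hc
      exact ⟨hzy, hf, by omega⟩
    · rintro ⟨-, hf, hc⟩
      refine ⟨h.lt.trans hzy, hf, ?_⟩
      rw [Set.ncard_insert_of_notMem hz hf, hc]
  · refine ⟨fun hk => ?_, fun hk => absurd hk.1 hyz.not_gt⟩
    obtain ⟨hxy, -, hc⟩ := hk
    have he : y = z := le_antisymm hyz (h.ge_of_gt hxy)
    subst he
    simp [h.Ioo_eq] at hc

theorem CovBy.adjRel_succ_right {z y : L} (h : z ⋖ y) (k : ℕ) (x : L) :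
    AdjRel (k + 1) x y ↔ AdjRel k x z := by
  rw [← adjRel_toDual (k + 1) y x, ← adjRel_toDual k z x]
  exact h.toDual.adjRel_succ k _

theorem AdjRel.exists_covBy {k : ℕ} {x y : L} (h : AdjRel k x y) : ∃ z, x ⋖ z := by
  obtain ⟨hxy, hf, -⟩ := h
  rcases (Set.Ioo x y).eq_empty_or_nonempty with he | hne
  · exact ⟨y, covBy_iff_Ioo_eq.2 ⟨hxy, he⟩⟩
  · obtain ⟨z, hz, hmin⟩ := Set.exists_min_image _ id hf hne
    exact ⟨z, hz.1, fun t hxt htz => (hmin t ⟨hxt, htz.trans hz.2⟩).not_gt htz⟩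

theorem adjRel_succ_iff {k : ℕ} {x y : L} :
    AdjRel (k + 1) x y ↔ sFun x ≠ x ∧ AdjRel k (sFun x) y := by
  rw [← exists_covBy_iff_sFun_ne]
  constructor
  · intro h
    obtain ⟨z, hz⟩ := h.exists_covBy
    rw [hz.sFun_eq]
    exact ⟨⟨z, hz⟩, (hz.adjRel_succ k y).1 h⟩
  · rintro ⟨⟨z, hz⟩, h⟩
    rw [hz.sFun_eq] at h
    exact (hz.adjRel_succ k y).2 h

theorem adjRel_zero_iff {x y : L} : AdjRel 0 x y ↔ x < y ∧ sFun x = y := by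
  rw [adjRel_zero]
  refine ⟨fun h => ⟨h.lt, h.sFun_eq⟩, ?_⟩
  rintro ⟨h, rfl⟩
  obtain ⟨z, hz⟩ := exists_covBy_iff_sFun_ne.2 h.ne'
  rwa [hz.sFun_eq]

theorem hasSuccChain_succ_iff {i : ℕ} {x : L} :
    HasSuccChain (i + 1) x ↔ sFun x ≠ x ∧ HasSuccChain i (sFun x) := by
  rw [← exists_covBy_iff_sFun_ne]
  constructor
  · rintro ⟨z, hz, h⟩
    rw [hz.sFun_eq]
    exact ⟨⟨z, hz⟩, h⟩
  · rintro ⟨⟨z, hz⟩, h⟩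
    rw [hz.sFun_eq] at h
    exact ⟨z, hz, h⟩

theorem hasPredChain_succ_iff {i : ℕ} {x : L} :
    HasPredChain (i + 1) x ↔ pFun x ≠ x ∧ HasPredChain i (pFun x) := by
  rw [← hasSuccChain_toDual, hasSuccChain_succ_iff, sFun_toDual, hasSuccChain_toDual]
  exact Iff.rfl

theorem OrderIso.map_sFun (σ : L ≃o L) (x : L) : σ (sFun x) = sFun (σ x) := by
  by_cases h : ∃ y, x ⋖ y
  · obtain ⟨y, hy⟩ := h
    rw [hy.sFun_eq, ((apply_covBy_apply_iff σ).2 hy).sFun_eq]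
  · rw [sFun_eq_self h, sFun_eq_self]
    rintro ⟨y, hy⟩
    refine h ⟨σ.symm y, (apply_covBy_apply_iff σ).1 ?_⟩
    rwa [σ.apply_symm_apply]

theorem OrderIso.map_pFun (σ : L ≃o L) (x : L) : σ (pFun x) = pFun (σ x) := by
  have h := OrderIso.map_sFun σ.dual (OrderDual.toDual x)
  rw [sFun_toDual] at h
  exact h.trans (sFun_toDual (σ x))

/-- The pairs `(x, y)` and `(x', y')` satisfy the same order, `S_i`, `P_j` and `Adj_k`
relations. -/
structure SameType (x y x' y' : L) : Prop where
  succ_left : ∀ i, HasSuccChain i x ↔ HasSuccChain i x'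
  pred_left : ∀ i, HasPredChain i x ↔ HasPredChain i x'
  succ_right : ∀ i, HasSuccChain i y ↔ HasSuccChain i y'
  pred_right : ∀ i, HasPredChain i y ↔ HasPredChain i y'
  lt : x < y ↔ x' < y'
  gt : y < x ↔ y' < x'
  adj : ∀ k, AdjRel k x y ↔ AdjRel k x' y'
  adj_symm : ∀ k, AdjRel k y x ↔ AdjRel k y' x'

namespace SameType

variable {x y x' y' : L}

theorem swap (h : SameType x y x' y') : SameType y x y' x' :=
  ⟨h.succ_right, h.pred_right, h.succ_left, h.pred_left, h.gt, h.lt, h.adj_symm, h.adj⟩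

theorem toDual (h : SameType x y x' y') :
    SameType (OrderDual.toDual x) (OrderDual.toDual y)
      (OrderDual.toDual x') (OrderDual.toDual y') where
  succ_left i := by simpa only [hasSuccChain_toDual] using h.pred_left i
  pred_left i := by simpa only [hasPredChain_toDual] using h.succ_left i
  succ_right i := by simpa only [hasSuccChain_toDual] using h.pred_right i
  pred_right i := by simpa only [hasPredChain_toDual] using h.succ_right i
  lt := h.gt
  gt := h.lt
  adj k := by simpa only [adjRel_toDual] using h.adj_symm k
  adj_symm k := by simpa only [adjRel_toDual] using h.adj k

theorem sFun_left (h : SameType x y x' y') : SameType (sFun x) y (sFun x') y' := by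
  have hex : (∃ z, x ⋖ z) ↔ ∃ z, x' ⋖ z := by
    simpa [HasSuccChain] using h.succ_left 1
  by_cases hx : ∃ z, x ⋖ z
  · obtain ⟨z, hz⟩ := hx
    obtain ⟨z', hz'⟩ := hex.1 ⟨z, hz⟩
    rw [hz.sFun_eq, hz'.sFun_eq]
    have lt_iff : ∀ {u v w : L}, u ⋖ v → (v < w ↔ u < w ∧ ¬AdjRel 0 u w) := by
      intro u v w huv
      rw [adjRel_zero]
      refine ⟨fun hw => ⟨huv.lt.trans hw, fun hc => hc.2 huv.lt hw⟩, ?_⟩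
      rintro ⟨huw, hc⟩
      refine (huv.ge_of_gt huw).lt_of_ne ?_
      rintro rfl
      exact hc huv
    have gt_iff : ∀ {u v w : L}, u ⋖ v → (w < v ↔ ¬u < w) := by
      intro u v w huv
      rw [not_lt]
      exact ⟨huv.le_of_lt, fun hw => hw.trans_lt huv.lt⟩
    have adj_iff : ∀ {u v w : L}, u ⋖ v → (AdjRel 0 w v ↔ ¬u < w ∧ ¬w < u) := by
      intro u v w huv
      rw [adjRel_zero, not_lt, not_lt]
      constructor
      · intro hw
        exact ⟨(huv.unique_left hw).ge, (huv.unique_left hw).le⟩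
      · rintro ⟨h1, h2⟩
        rwa [le_antisymm h1 h2]
    refine ⟨fun i => ?_, fun i => ?_, h.succ_right, h.pred_right, ?_, ?_, fun k => ?_,
      fun k => ?_⟩
    · rw [← hz.hasSuccChain_succ, ← hz'.hasSuccChain_succ]
      exact h.succ_left _
    · cases i with
      | zero => exact Iff.rfl
      | succ i =>
        rw [hz.hasPredChain_succ, hz'.hasPredChain_succ]
        exact h.pred_left i
    · rw [lt_iff hz, lt_iff hz', h.lt, h.adj]
    · rw [gt_iff hz, gt_iff hz', h.lt]
    · rw [← hz.adjRel_succ, ← hz'.adjRel_succ]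
      exact h.adj _
    · cases k with
      | zero => rw [adj_iff hz, adj_iff hz', h.lt, h.gt]
      | succ k =>
        rw [hz.adjRel_succ_right, hz'.adjRel_succ_right]
        exact h.adj_symm k
  · rwa [sFun_eq_self hx, sFun_eq_self fun hx' => hx (hex.2 hx')]

theorem pFun_left (h : SameType x y x' y') : SameType (pFun x) y (pFun x') y' := by
  have := h.toDual.sFun_left
  rw [sFun_toDual, sFun_toDual] at this
  exact this.toDual

end SameType

/-- The action of a word in the letters `s` (`true`) and `p` (`false`). -/
noncomputable def spWord : List Bool → L → L
  | [], x => x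
  | true :: w, x => sFun (spWord w x)
  | false :: w, x => pFun (spWord w x)

theorem SameType.spWord_left {x y x' y' : L} (h : SameType x y x' y') (w : List Bool) :
    SameType (spWord w x) y (spWord w x') y' := by
  induction w with
  | nil => exact h
  | cons c w ih =>
    cases c
    · exact ih.pFun_left
    · exact ih.sFun_left

theorem SameType.spWord {x y x' y' : L} (h : SameType x y x' y') (v w : List Bool) :
    SameType (spWord v x) (spWord w y) (spWord v x') (spWord w y') :=
  ((h.spWord_left v).swap.spWord_left w).swap

theorem subset_spClosure (A : Set L) : A ⊆ spClosure L A :=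
  fun _ hx _ hB => hB.1 hx

theorem sFun_mem_spClosure {A : Set L} {x : L} (hx : x ∈ spClosure L A) :
    sFun x ∈ spClosure L A :=
  fun B hB => (hB.2 x (hx B hB)).1

theorem pFun_mem_spClosure {A : Set L} {x : L} (hx : x ∈ spClosure L A) :
    pFun x ∈ spClosure L A :=
  fun B hB => (hB.2 x (hx B hB)).2

theorem spWord_mem_spClosure {A : Set L} {x : L} (hx : x ∈ spClosure L A) (w : List Bool) :
    spWord w x ∈ spClosure L A := by
  induction w with
  | nil => exact hx
  | cons c w ih =>
    cases c
    · exact pFun_mem_spClosure ih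
    · exact sFun_mem_spClosure ih

theorem mem_spClosure_iff {A : Set L} {u : L} :
    u ∈ spClosure L A ↔ ∃ w, ∃ x ∈ A, spWord w x = u := by
  constructor
  · intro hu
    refine hu {u | ∃ w, ∃ x ∈ A, spWord w x = u} ⟨fun x hx => ⟨[], x, hx, rfl⟩, ?_⟩
    rintro _ ⟨w, x, hx, rfl⟩
    exact ⟨⟨true :: w, x, hx, rfl⟩, ⟨false :: w, x, hx, rfl⟩⟩
  · rintro ⟨w, x, hx, rfl⟩
    exact spWord_mem_spClosure (subset_spClosure A hx) w

theorem IsSPHomogeneous.of_cnmHomogeneous (h : CnmHomogeneous ⊤ ⊤ L) : IsSPHomogeneous L := by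
  classical
  rintro n a b ⟨g, hbij, hlt, hs, hp, hab⟩
  have hinj := hbij.injOn
  have hsne : ∀ x ∈ spClosure L (Set.range a), (sFun x ≠ x ↔ sFun (g x) ≠ g x) := by
    intro x hx
    rw [← hs x hx, ne_eq, ne_eq, hinj.eq_iff (sFun_mem_spClosure hx) hx]
  have hpne : ∀ x ∈ spClosure L (Set.range a), (pFun x ≠ x ↔ pFun (g x) ≠ g x) := by
    intro x hx
    rw [← hp x hx, ne_eq, ne_eq, hinj.eq_iff (pFun_mem_spClosure hx) hx]
  have hsucc : ∀ i, ∀ x ∈ spClosure L (Set.range a),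
      (HasSuccChain i x ↔ HasSuccChain i (g x)) := by
    intro i
    induction i with
    | zero => exact fun _ _ => Iff.rfl
    | succ i ih =>
      intro x hx
      rw [hasSuccChain_succ_iff, hasSuccChain_succ_iff, hsne x hx,
        ih _ (sFun_mem_spClosure hx), hs x hx]
  have hpred : ∀ i, ∀ x ∈ spClosure L (Set.range a),
      (HasPredChain i x ↔ HasPredChain i (g x)) := by
    intro i
    induction i with
    | zero => exact fun _ _ => Iff.rfl
    | succ i ih =>
      intro x hx
      rw [hasPredChain_succ_iff, hasPredChain_succ_iff, hpne x hx,
        ih _ (pFun_mem_spClosure hx), hp x hx]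
  have hadj : ∀ k, ∀ x ∈ spClosure L (Set.range a), ∀ y ∈ spClosure L (Set.range a),
      (AdjRel k x y ↔ AdjRel k (g x) (g y)) := by
    intro k
    induction k with
    | zero =>
      intro x hx y hy
      rw [adjRel_zero_iff, adjRel_zero_iff, ← hlt x hx y hy, ← hs x hx,
        hinj.eq_iff (sFun_mem_spClosure hx) hy]
    | succ k ih =>
      intro x hx y hy
      rw [adjRel_succ_iff, adjRel_succ_iff, hsne x hx, ih _ (sFun_mem_spClosure hx) y hy,
        hs x hx]
  have hA : ∀ x ∈ Finset.univ.image a, x ∈ spClosure L (Set.range a) := by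
    intro x hx
    obtain ⟨i, -, rfl⟩ := Finset.mem_image.1 hx
    exact subset_spClosure _ ⟨i, rfl⟩
  obtain ⟨σ, hσ⟩ := h (Finset.univ.image a) g (hinj.mono hA)
    (fun x hx y hy => hlt x (hA x hx) y (hA y hy)) (fun i _ x hx => hsucc i x (hA x hx))
    (fun i _ x hx => hpred i x (hA x hx))
    (fun k _ x hx y hy => hadj k x (hA x hx) y (hA y hy))
  refine ⟨σ, σ.map_sFun, σ.map_pFun, fun i => ?_⟩
  rw [hσ _ (Finset.mem_image_of_mem a (Finset.mem_univ i)), hab]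

theorem IsSPHomogeneous.cnmHomogeneous (h : IsSPHomogeneous L) : CnmHomogeneous ⊤ ⊤ L := by
  classical
  intro A g _ hlt hsucc hpred hadj
  have hsame : ∀ x ∈ A, ∀ y ∈ A, ∀ v w, SameType (spWord v x) (spWord w y)
      (spWord v (g x)) (spWord w (g y)) := by
    intro x hx y hy v w
    refine SameType.spWord ?_ v w
    exact ⟨fun i => hsucc i (ENat.natCast_lt_top i) x hx,
      fun i => hpred i (ENat.natCast_lt_top i) x hx,
      fun i => hsucc i (ENat.natCast_lt_top i) y hy, fun i => hpred i (ENat.natCast_lt_top i) y hy,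
      hlt x hx y hy, hlt y hy x hx, fun k => hadj k (by simp) x hx y hy,
      fun k => hadj k (by simp) y hy x hx⟩
  have hextend : ∀ u, ∃ t, ∀ w, ∀ x ∈ A, spWord w x = u → spWord w (g x) = t := by
    intro u
    by_cases hu : ∃ w, ∃ x ∈ A, spWord w x = u
    · obtain ⟨v, x, hx, rfl⟩ := hu
      refine ⟨spWord v (g x), fun w y hy he => ?_⟩
      have hT := hsame x hx y hy v w
      exact le_antisymm (not_lt.1 fun hc => (hT.lt.2 hc).ne he.symm)
        (not_lt.1 fun hc => (hT.gt.2 hc).ne he)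
    · exact ⟨u, fun w x hx he => absurd ⟨w, x, hx, he⟩ hu⟩
  choose G hG using hextend
  have hGw : ∀ w, ∀ x ∈ A, G (spWord w x) = spWord w (g x) :=
    fun w x hx => (hG _ w x hx rfl).symm
  let a : Fin A.card → L := fun i => (A.equivFin.symm i : L)
  have ha : ∀ i, a i ∈ A := fun i => (A.equivFin.symm i).2
  have hsurj : ∀ x ∈ A, ∃ i, a i = x := fun x hx =>
    ⟨A.equivFin ⟨x, hx⟩, by simp [a]⟩
  have hcl : ∀ u ∈ spClosure L (Set.range a), ∃ w, ∃ x ∈ A, spWord w x = u := by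
    intro u hu
    obtain ⟨w, _, ⟨i, rfl⟩, rfl⟩ := mem_spClosure_iff.1 hu
    exact ⟨w, a i, ha i, rfl⟩
  have hGlt : ∀ x ∈ spClosure L (Set.range a), ∀ y ∈ spClosure L (Set.range a),
      (x < y ↔ G x < G y) := by
    intro u hu t ht
    obtain ⟨v, x, hx, rfl⟩ := hcl u hu
    obtain ⟨w, y, hy, rfl⟩ := hcl t ht
    rw [hGw v x hx, hGw w y hy]
    exact (hsame x hx y hy v w).lt
  suffices hext : ∃ σ : L ≃o L, (∀ x, σ (sFun x) = sFun (σ x)) ∧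
      (∀ x, σ (pFun x) = pFun (σ x)) ∧ ∀ i, σ (a i) = g (a i) by
    obtain ⟨σ, -, -, hσ⟩ := hext
    refine ⟨σ, fun x hx => ?_⟩
    obtain ⟨i, rfl⟩ := hsurj x hx
    exact hσ i
  refine h A.card a (fun i => g (a i)) ⟨G, ⟨?_, ?_, ?_⟩, hGlt, ?_, ?_, ?_⟩
  · intro u hu
    obtain ⟨w, _, ⟨i, rfl⟩, rfl⟩ := mem_spClosure_iff.1 hu
    rw [hGw w _ (ha i)]
    exact mem_spClosure_iff.2 ⟨w, _, ⟨i, rfl⟩, rfl⟩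
  · intro u hu t ht he
    exact le_antisymm (not_lt.1 fun hc => ((hGlt t ht u hu).1 hc).ne he.symm)
      (not_lt.1 fun hc => ((hGlt u hu t ht).1 hc).ne he)
  · intro u hu
    obtain ⟨w, _, ⟨i, rfl⟩, rfl⟩ := mem_spClosure_iff.1 hu
    exact ⟨spWord w (a i), mem_spClosure_iff.2 ⟨w, _, ⟨i, rfl⟩, rfl⟩, hGw w _ (ha i)⟩
  · intro u hu
    obtain ⟨w, x, hx, rfl⟩ := hcl u hu
    rw [hGw w x hx]
    exact hGw (true :: w) x hx
  · intro u hu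
    obtain ⟨w, x, hx, rfl⟩ := hcl u hu
    rw [hGw w x hx]
    exact hGw (false :: w) x hx
  · exact fun i => hGw [] _ (ha i)

end SuccPred

/-- A countable linear order is `C_{∞,∞}`-homogeneous iff it is sp-homogeneous. -/
theorem stmt0 (L : Type) [LinearOrder L] [Countable L] :
    CnmHomogeneous ⊤ ⊤ L ↔ IsSPHomogeneous L :=
  ⟨IsSPHomogeneous.of_cnmHomogeneous, IsSPHomogeneous.cnmHomogeneous⟩
end

section
/- For all finite n, m ∈ ℕ, there are, up to order-isomorphism, only finitely many countable C_{n,m}-homogeneous linear orders. -/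
section AtomicTypes

variable {L M : Type*} [LinearOrder L] [LinearOrder M]

theorem HasSuccChain.map (σ : L ≃o M) :
    ∀ (i : ℕ) (x : L), HasSuccChain i x → HasSuccChain i (σ x)
  | 0, _, _ => trivial
  | i + 1, _, ⟨y, hxy, hy⟩ =>
    ⟨σ y, (apply_covBy_apply_iff σ).2 hxy, HasSuccChain.map σ i y hy⟩

theorem HasPredChain.map (σ : L ≃o M) :
    ∀ (i : ℕ) (x : L), HasPredChain i x → HasPredChain i (σ x)
  | 0, _, _ => trivial
  | i + 1, _, ⟨y, hxy, hy⟩ =>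
    ⟨σ y, (apply_covBy_apply_iff σ).2 hxy, HasPredChain.map σ i y hy⟩

theorem hasSuccChain_apply_iff (σ : L ≃o M) (i : ℕ) (x : L) :
    HasSuccChain i (σ x) ↔ HasSuccChain i x :=
  ⟨fun h => by simpa using h.map σ.symm, HasSuccChain.map σ i x⟩

theorem hasPredChain_apply_iff (σ : L ≃o M) (i : ℕ) (x : L) :
    HasPredChain i (σ x) ↔ HasPredChain i x :=
  ⟨fun h => by simpa using h.map σ.symm, HasPredChain.map σ i x⟩

theorem adjRel_iff_encard {k : ℕ} {x y : L} :
    AdjRel k x y ↔ x < y ∧ (Set.Ioo x y).encard = k := by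
  refine and_congr_right fun _ => ⟨fun ⟨hf, hk⟩ => ?_, fun h => ?_⟩
  · rw [← hf.cast_ncard_eq, hk]
  · exact ⟨Set.finite_of_encard_eq_coe h, by simp [Set.ncard, h]⟩

theorem adjRel_apply_iff (σ : L ≃o M) (k : ℕ) (x y : L) :
    AdjRel k (σ x) (σ y) ↔ AdjRel k x y := by
  rw [adjRel_iff_encard, adjRel_iff_encard, ← OrderIso.image_Ioo, σ.injective.encard_image,
    σ.lt_iff_lt]

theorem encard_Ioo_eq_add {a b c : L} (hab : a < b) (hbc : b < c) :
    (Set.Ioo a c).encard = (Set.Ioo a b).encard + (Set.Ioo b c).encard + 1 := by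
  have hu : Set.Ioo a c = insert b (Set.Ioo a b ∪ Set.Ioo b c) := by
    ext z
    simp only [Set.mem_Ioo, Set.mem_insert_iff, Set.mem_union]
    grind
  rw [hu, Set.encard_insert_of_notMem (by simp), Set.encard_union_eq]
  exact Set.disjoint_left.2 fun z h h' => (h.2.trans h'.1).false

theorem adjRel_iff_exists {k : ℕ} {a b c : L} (hab : a < b) (hbc : b < c) :
    AdjRel k a c ↔ ∃ i j : ℕ, i + j + 1 = k ∧ AdjRel i a b ∧ AdjRel j b c := by
  simp only [adjRel_iff_encard, hab, hbc, hab.trans hbc, true_and, encard_Ioo_eq_add hab hbc]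
  constructor
  · intro h
    have hi : (Set.Ioo a b).encard ≠ ⊤ := by
      rintro h'
      simp [h'] at h
    have hj : (Set.Ioo b c).encard ≠ ⊤ := by
      rintro h'
      simp [h'] at h
    lift (Set.Ioo a b).encard to ℕ using hi with i
    lift (Set.Ioo b c).encard to ℕ using hj with j
    exact ⟨i, j, by exact_mod_cast h, rfl, rfl⟩
  · rintro ⟨i, j, rfl, hi, hj⟩
    simp [hi, hj]

/-- The atomic type of an ordered pair in the language of `C_{n,m}`-homogeneity; the unary
relations are recorded for the first entry only. -/
def pairType (n m : ℕ) (x y : L) :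
    Prop × (Fin n → Prop) × (Fin m → Prop) × (Fin (n + m) → Prop) :=
  (x < y, fun i => HasSuccChain i x, fun j => HasPredChain j x, fun k => AdjRel k x y)

/-- The set of atomic types of triples realised in `L`. -/
def tripleTypes (n m : ℕ) (L : Type*) [LinearOrder L] :
    Set (Fin 3 → Fin 3 → Prop × (Fin n → Prop) × (Fin m → Prop) × (Fin (n + m) → Prop)) :=
  Set.range fun (t : Fin 3 → L) i j => pairType n m (t i) (t j)

variable {n m : ℕ}

theorem pairType_eq_iff {x y : L} {x' y' : M} :
    pairType n m x y = pairType n m x' y' ↔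
      (x < y ↔ x' < y') ∧ (∀ i < n, (HasSuccChain i x ↔ HasSuccChain i x')) ∧
      (∀ j < m, (HasPredChain j x ↔ HasPredChain j x')) ∧
      ∀ k < n + m, (AdjRel k x y ↔ AdjRel k x' y') := by
  simp [pairType, Prod.ext_iff, funext_iff, Fin.forall_iff]

theorem pairType_apply (σ : L ≃o M) (x y : L) :
    pairType n m (σ x) (σ y) = pairType n m x y := by
  simp [pairType_eq_iff, hasSuccChain_apply_iff, hasPredChain_apply_iff, adjRel_apply_iff]

theorem lt_iff_of_pairType_eq {x y : L} {x' y' : M}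
    (h : pairType n m x y = pairType n m x' y') : x < y ↔ x' < y' :=
  (pairType_eq_iff.1 h).1

theorem eq_iff_of_pairType_eq {x y : L} {x' y' : M}
    (h : pairType n m x y = pairType n m x' y') (h' : pairType n m y x = pairType n m y' x') :
    x = y ↔ x' = y' := by
  have h₁ := lt_iff_of_pairType_eq h
  have h₂ := lt_iff_of_pairType_eq h'
  grind

theorem pairType_trans {a b c : L} {a' b' c' : M} (hab : a < b) (hbc : b < c)
    (h₁ : pairType n m a b = pairType n m a' b') (h₂ : pairType n m b c = pairType n m b' c') :
    pairType n m a c = pairType n m a' c' := by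
  have hab' := (lt_iff_of_pairType_eq h₁).1 hab
  have hbc' := (lt_iff_of_pairType_eq h₂).1 hbc
  rw [pairType_eq_iff] at h₁ h₂ ⊢
  refine ⟨by simp [hab.trans hbc, hab'.trans hbc'], h₁.2.1, h₁.2.2.1, fun k hk => ?_⟩
  rw [adjRel_iff_exists hab hbc, adjRel_iff_exists hab' hbc']
  refine exists_congr fun i => exists_congr fun j => and_congr_right fun hij => ?_
  rw [h₁.2.2.2 i (by omega), h₂.2.2.2 j (by omega)]

theorem pairType_eq_of_lt {x y : L} {x' y' : M} (hxy : x < y) (hxy' : x' < y')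
    (h : pairType n m y y = pairType n m y' y') : pairType n m y x = pairType n m y' x' := by
  rw [pairType_eq_iff] at h ⊢
  refine ⟨iff_of_false hxy.not_gt hxy'.not_gt, h.2.1, h.2.2.1, fun k _ => ?_⟩
  exact iff_of_false (fun h' => hxy.not_gt h'.1) fun h' => hxy'.not_gt h'.1

theorem CnmHomogeneous.exists_orderIso (hL : CnmHomogeneous (n : ℕ∞) (m : ℕ∞) L)
    {ι : Type*} [Finite ι] (a b : ι → L)
    (h : ∀ i j, pairType n m (a i) (a j) = pairType n m (b i) (b j)) :
    ∃ σ : L ≃o L, ∀ i, σ (a i) = b i := by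
  classical
  have := Fintype.ofFinite ι
  have hinj : ∀ i j, a i = a j ↔ b i = b j := fun i j => eq_iff_of_pairType_eq (h i j) (h j i)
  obtain ⟨g, hg⟩ : ∃ g : L → L, ∀ i, g (a i) = b i :=
    ⟨fun y => if hy : ∃ i, a i = y then b hy.choose else y, fun i => by
      have hi : ∃ j, a j = a i := ⟨i, rfl⟩
      simp only [dif_pos hi]
      exact (hinj _ _).1 hi.choose_spec⟩
  have hall : ∀ i j, _ := fun i j => pairType_eq_iff.1 (h i j)
  obtain ⟨σ, hσ⟩ := hL (Finset.univ.image a) g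
    (by
      intro x hx y hy
      simp only [Finset.coe_image, Finset.coe_univ, Set.image_univ, Set.mem_range] at hx hy
      obtain ⟨i, rfl⟩ := hx
      obtain ⟨j, rfl⟩ := hy
      simp only [hg]
      exact (hinj i j).2)
    (by simpa [hg] using fun i j => (hall i j).1)
    (by simpa [hg] using fun k hk i => (hall i i).2.1 k hk)
    (by simpa [hg] using fun k hk i => (hall i i).2.2.1 k hk)
    (by simpa [hg] using fun k hk i j => (hall i j).2.2.2 k (by exact_mod_cast hk))
  exact ⟨σ, fun i => by rw [hσ (a i) (by simp), hg]⟩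

theorem exists_neighbours {ι : Type*} [Finite ι] [Nonempty ι] (a : ι → L) (x : L) :
    ∃ u v : ι, (∀ i, a i < x → a i ≤ a u ∧ a u < x) ∧ (∀ i, x < a i → a v ≤ a i ∧ x < a v) := by
  obtain ⟨u, hu⟩ : ∃ u, ∀ i, a i < x → a i ≤ a u ∧ a u < x := by
    by_cases h : {i | a i < x}.Nonempty
    · obtain ⟨u, hux, hu⟩ := Set.exists_max_image _ a (Set.toFinite _) h
      exact ⟨u, fun i hi => ⟨hu i hi, hux⟩⟩
    · exact ⟨Classical.arbitrary ι, fun i hi => (h ⟨i, hi⟩).elim⟩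
  obtain ⟨v, hv⟩ : ∃ v, ∀ i, x < a i → a v ≤ a i ∧ x < a v := by
    by_cases h : {i | x < a i}.Nonempty
    · obtain ⟨v, hvx, hv⟩ := Set.exists_min_image _ a (Set.toFinite _) h
      exact ⟨v, fun i hi => ⟨hv i hi, hvx⟩⟩
    · exact ⟨Classical.arbitrary ι, fun i hi => (h ⟨i, hi⟩).elim⟩
  exact ⟨u, v, hu, hv⟩

/-- One-point extension of a finite partial isomorphism: the type of the new point over a finite
set is determined by its type over its two neighbours. -/
theorem CnmHomogeneous.exists_extension (hM : CnmHomogeneous (n : ℕ∞) (m : ℕ∞) M)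
    (hLM : tripleTypes n m L ⊆ tripleTypes n m M) {ι : Type*} [Finite ι] (a : ι → L) (b : ι → M)
    (h : ∀ i j, pairType n m (a i) (a j) = pairType n m (b i) (b j)) (x : L) :
    ∃ x' : M, pairType n m x x = pairType n m x' x' ∧
      ∀ i, pairType n m (a i) x = pairType n m (b i) x' ∧
        pairType n m x (a i) = pairType n m x' (b i) := by
  have key : ∀ t : Fin 3 → L, ∃ t' : Fin 3 → M,
      ∀ i j, pairType n m (t' i) (t' j) = pairType n m (t i) (t j) := fun t => by
    obtain ⟨t', ht'⟩ := hLM ⟨t, rfl⟩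
    exact ⟨t', fun i j => congrFun (congrFun ht' i) j⟩
  rcases isEmpty_or_nonempty ι with hι | hι
  · obtain ⟨t', ht'⟩ := key fun _ => x
    exact ⟨t' 0, (ht' 0 0).symm, fun i => isEmptyElim i⟩
  by_cases hx : ∃ i, a i = x
  · obtain ⟨i, rfl⟩ := hx
    exact ⟨b i, h i i, fun j => ⟨h j i, h i j⟩⟩
  obtain ⟨u, v, hu, hv⟩ := exists_neighbours a x
  obtain ⟨t', ht'⟩ := key ![a u, x, a v]
  obtain ⟨σ, hσ⟩ := hM.exists_orderIso ![t' 0, t' 2] ![b u, b v] (by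
    have h₀₀ := ht' 0 0
    have h₀₂ := ht' 0 2
    have h₂₀ := ht' 2 0
    have h₂₂ := ht' 2 2
    simp at h₀₀ h₀₂ h₂₀ h₂₂
    simp [Fin.forall_fin_two, *])
  have hσu : σ (t' 0) = b u := hσ 0
  have hσv : σ (t' 2) = b v := hσ 1
  have hxx : pairType n m x x = pairType n m (σ (t' 1)) (σ (t' 1)) := by
    rw [pairType_apply, ht']
    rfl
  have hux : pairType n m (a u) x = pairType n m (b u) (σ (t' 1)) := by
    rw [← hσu, pairType_apply, ht']
    rfl
  have hxv : pairType n m x (a v) = pairType n m (σ (t' 1)) (b v) := by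
    rw [← hσv, pairType_apply, ht']
    rfl
  refine ⟨σ (t' 1), hxx, fun i => ?_⟩
  rcases lt_or_gt_of_ne (fun h' => hx ⟨i, h'⟩ : a i ≠ x) with hi | hi
  · obtain ⟨hiu, hlt⟩ := hu i hi
    have hix : pairType n m (a i) x = pairType n m (b i) (σ (t' 1)) := by
      rcases hiu.eq_or_lt with heq | hiu
      · rwa [heq, (eq_iff_of_pairType_eq (h i u) (h u i)).1 heq]
      · exact pairType_trans hiu hlt (h i u) hux
    exact ⟨hix, pairType_eq_of_lt hi ((lt_iff_of_pairType_eq hix).1 hi) hxx⟩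
  · obtain ⟨hvi, hlt⟩ := hv i hi
    have hxi : pairType n m x (a i) = pairType n m (σ (t' 1)) (b i) := by
      rcases hvi.eq_or_lt with heq | hvi
      · rwa [← heq, ← (eq_iff_of_pairType_eq (h v i) (h i v)).1 heq]
      · exact pairType_trans hlt hvi hxv (h v i)
    exact ⟨pairType_eq_of_lt hi ((lt_iff_of_pairType_eq hxi).1 hi) (h i i), hxi⟩

/-- Finite partial isomorphisms in the language of `C_{n,m}`-homogeneity. -/
abbrev FinPartialIso (n m : ℕ) (L M : Type*) [LinearOrder L] [LinearOrder M] : Type _ :=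
  {f : Finset (L × M) // ∀ p ∈ f, ∀ q ∈ f, pairType n m p.1 q.1 = pairType n m p.2 q.2}

theorem FinPartialIso.exists_insert (f : FinPartialIso n m L M) {x : L} {x' : M}
    (hxx : pairType n m x x = pairType n m x' x')
    (hx : ∀ p : f.1, pairType n m p.1.1 x = pairType n m p.1.2 x' ∧
      pairType n m x p.1.1 = pairType n m x' p.1.2) :
    ∃ g : FinPartialIso n m L M, (x, x') ∈ g.1 ∧ f ≤ g := by
  classical
  refine ⟨⟨insert (x, x') f.1, fun p hp q hq => ?_⟩, Finset.mem_insert_self _ _,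
    Finset.subset_insert _ _⟩
  rcases Finset.mem_insert.1 hp with rfl | hp <;> rcases Finset.mem_insert.1 hq with rfl | hq
  · exact hxx
  · exact (hx ⟨q, hq⟩).2
  · exact (hx ⟨p, hp⟩).1
  · exact f.2 p hp q hq

/-- A countable `C_{n,m}`-homogeneous linear order is determined up to isomorphism by the atomic
types of triples that it realises. -/
theorem CnmHomogeneous.nonempty_orderIso [Countable L] [Countable M]
    (hL : CnmHomogeneous (n : ℕ∞) (m : ℕ∞) L) (hM : CnmHomogeneous (n : ℕ∞) (m : ℕ∞) M)
    (hLM : tripleTypes n m L = tripleTypes n m M) : Nonempty (L ≃o M) := by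
  have := Encodable.ofCountable L
  have := Encodable.ofCountable M
  let left : L → Order.Cofinal (FinPartialIso n m L M) := fun x =>
    { carrier := {f | ∃ y, (x, y) ∈ f.1}
      isCofinal := fun f => by
        obtain ⟨y, hxy, hy⟩ := hM.exists_extension hLM.subset (fun p : f.1 => p.1.1)
          (fun p => p.1.2) (fun p q => f.2 _ p.2 _ q.2) x
        obtain ⟨g, hg, hfg⟩ := f.exists_insert hxy hy
        exact ⟨g, ⟨y, hg⟩, hfg⟩ }
  let right : M → Order.Cofinal (FinPartialIso n m L M) := fun y =>
    { carrier := {f | ∃ x, (x, y) ∈ f.1}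
      isCofinal := fun f => by
        obtain ⟨x, hxy, hx⟩ := hL.exists_extension hLM.superset (fun p : f.1 => p.1.2)
          (fun p => p.1.1) (fun p q => (f.2 _ p.2 _ q.2).symm) y
        obtain ⟨g, hg, hfg⟩ := f.exists_insert hxy.symm fun p => ⟨(hx p).1.symm, (hx p).2.symm⟩
        exact ⟨g, ⟨x, hg⟩, hfg⟩ }
  let I := Order.idealOfCofinals (⟨∅, by simp⟩ : FinPartialIso n m L M) (Sum.elim left right)
  have hleft : ∀ x, ∃ y, ∃ f ∈ I, (x, y) ∈ f.1 := fun x => by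
    obtain ⟨f, ⟨y, hy⟩, hf⟩ := Order.cofinal_meets_idealOfCofinals
      (⟨∅, by simp⟩ : FinPartialIso n m L M) (Sum.elim left right) (Sum.inl x)
    exact ⟨y, f, hf, hy⟩
  have hright : ∀ y, ∃ x, ∃ f ∈ I, (x, y) ∈ f.1 := fun y => by
    obtain ⟨f, ⟨x, hx⟩, hf⟩ := Order.cofinal_meets_idealOfCofinals
      (⟨∅, by simp⟩ : FinPartialIso n m L M) (Sum.elim left right) (Sum.inr y)
    exact ⟨x, f, hf, hx⟩
  choose F hF using hleft
  choose G hG using hright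
  refine ⟨OrderIso.ofCmpEqCmp F G fun x y => ?_⟩
  obtain ⟨f, hfI, hf⟩ := hF x
  obtain ⟨g, hgI, hg⟩ := hG y
  obtain ⟨k, -, hfk, hgk⟩ := I.directed f hfI g hgI
  have h₁ := lt_iff_of_pairType_eq (k.2 _ (hfk hf) _ (hgk hg))
  have h₂ := lt_iff_of_pairType_eq (k.2 _ (hgk hg) _ (hfk hf))
  simp only at h₁ h₂
  simp [cmp, cmpUsing, h₁, h₂]

theorem tripleTypes_congr (e : L ≃o M) : tripleTypes n m L = tripleTypes n m M := by
  refine Set.Subset.antisymm ?_ ?_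
  · rintro _ ⟨t, rfl⟩
    exact ⟨e ∘ t, by simp [pairType_apply]⟩
  · rintro _ ⟨t, rfl⟩
    exact ⟨e.symm ∘ t, by simp [pairType_apply]⟩

theorem CnmHomogeneous.congr (hL : CnmHomogeneous (n : ℕ∞) (m : ℕ∞) L) (e : L ≃o M) :
    CnmHomogeneous (n : ℕ∞) (m : ℕ∞) M := by
  intro A g _ hlt hS hP hAdj
  obtain ⟨σ, hσ⟩ := hL.exists_orderIso (fun x : A => e.symm x) (fun x => e.symm (g x))
    fun x y => by
      rw [pairType_apply, pairType_apply, pairType_eq_iff]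
      exact ⟨hlt _ x.2 _ y.2, fun i hi => hS i (by exact_mod_cast hi) _ x.2,
        fun j hj => hP j (by exact_mod_cast hj) _ x.2,
        fun k hk => hAdj k (by exact_mod_cast hk) _ x.2 _ y.2⟩
  exact ⟨(e.symm.trans σ).trans e, fun x hx => by simp [hσ ⟨x, hx⟩]⟩

end AtomicTypes

/-- For all finite `n, m`, there are, up to order-isomorphism, only finitely many
countable `C_{n,m}`-homogeneous linear orders: there is a finite set of suborders of `ℚ`
such that every countable `C_{n,m}`-homogeneous linear order is order-isomorphic to one
of them. -/
theorem stmt7 (n m : ℕ) :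
    ∃ F : Finset (Set ℚ), ∀ (L : Type) [LinearOrder L] [Countable L],
      CnmHomogeneous (n : ℕ∞) (m : ℕ∞) L → ∃ B ∈ F, Nonempty (L ≃o ↥B) := by
  classical
  let realises (B : Set ℚ) (T : Set _) : Prop :=
    CnmHomogeneous (n : ℕ∞) (m : ℕ∞) B ∧ tripleTypes n m B = T
  let rep (T : Set _) : Set ℚ := if h : ∃ B, realises B T then h.choose else ∅
  refine ⟨(Set.finite_range rep).toFinset, fun L _ _ hL => ?_⟩
  obtain ⟨e⟩ := Order.embedding_from_countable_to_dense L ℚ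
  let e' : L ≃o Set.range e := e.orderIso
  have h : ∃ B, realises B (tripleTypes n m L) :=
    ⟨Set.range e, hL.congr e', tripleTypes_congr e'.symm⟩
  refine ⟨rep (tripleTypes n m L), by simp, ?_⟩
  have hrep : realises (rep (tripleTypes n m L)) (tripleTypes n m L) := by
    simp only [rep, dif_pos h]
    exact h.choose_spec
  exact hL.nonempty_orderIso hrep.1 hrep.2.symm
end

section
/- For every k ≥ 1, I(k) = 1 + Σ_{m=1}^{k} C(k, m) · Σ_{n=1}^{m} Σ_{r=0}^{⌈n/2⌉} C(n−r+1, r)·C(m, r)·r!·(n−r)!·S(m−r, n−r), where the leading summand 1 accounts for the empty ordering and S denotes the Stirling numbers of the second kind. -/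
/-- `K12 i = (K₁ i, K₂ i)` where `K₁ 0 = 1`, `K₂ 0 = 0`,
`K₁ (i+1) = ∑_{j=0}^{i} C(i+1, j) (K₁ j + K₂ j)` and `K₂ (i+1) = (i+1) K₁ i`. -/
def K12 : ℕ → ℕ × ℕ
  | 0 => (1, 0)
  | (i+1) =>
    ((Finset.range (i+1)).attach.sum
        (fun j => Nat.choose (i+1) j.1 * ((K12 j.1).1 + (K12 j.1).2)),
      (i+1) * (K12 i).1)
decreasing_by
  · exact Finset.mem_range.mp j.2
  · exact Nat.lt_succ_self i

/-- `I(k) = ∑_{i=0}^{k} (K₁ i + K₂ i) C(k, i)`. -/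
def Ifun (k : ℕ) : ℕ :=
  ∑ i ∈ Finset.range (k+1), ((K12 i).1 + (K12 i).2) * Nat.choose k i

/-- `stirling2 a b` is the Stirling number of the second kind: the number of partitions
of an `a`-element set into `b` nonempty parts. -/
def stirling2 : ℕ → ℕ → ℕ
  | 0, 0 => 1
  | 0, _+1 => 0
  | _+1, 0 => 0
  | a+1, b+1 => (b+1) * stirling2 a (b+1) + stirling2 a b

open PowerSeries Finset

theorem K12_zero : K12 0 = (1, 0) := by
  rw [K12]

theorem K12_succ_fst (i : ℕ) :
    (K12 (i + 1)).1 = ∑ j ∈ range (i + 1), (i + 1).choose j * ((K12 j).1 + (K12 j).2) := by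
  rw [K12]
  exact Finset.sum_attach (range (i + 1))
    fun j => (i + 1).choose j * ((K12 j).1 + (K12 j).2)

theorem K12_succ_snd (i : ℕ) : (K12 (i + 1)).2 = (i + 1) * (K12 i).1 := by
  rw [K12]

theorem stirling2_eq_zero_of_lt : ∀ {a b : ℕ}, a < b → stirling2 a b = 0
  | _, 0, h => by omega
  | 0, _ + 1, _ => by rw [stirling2]
  | a + 1, b + 1, h => by
    rw [stirling2, stirling2_eq_zero_of_lt (show a < b + 1 by omega),
      stirling2_eq_zero_of_lt (show a < b by omega), mul_zero]

/-- The exponential generating function of `K₁`. -/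
noncomputable def egfK₁ : ℚ⟦X⟧ := PowerSeries.mk fun i => ((K12 i).1 : ℚ) / i.factorial

/-- The exponential generating function of `K₁ + K₂`. -/
noncomputable def egfK : ℚ⟦X⟧ :=
  PowerSeries.mk fun i => (((K12 i).1 + (K12 i).2 : ℕ) : ℚ) / i.factorial

theorem egfK_eq : egfK = (1 + X) * egfK₁ := by
  ext n
  rw [add_mul, one_mul, map_add]
  cases n with
  | zero => simp [egfK, egfK₁, K12_zero]
  | succ n =>
    rw [coeff_succ_X_mul]
    simp only [egfK, egfK₁, coeff_mk, K12_succ_snd, Nat.factorial_succ]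
    push_cast
    field_simp

theorem egfK₁_eq : egfK₁ = 1 + (exp ℚ - 1) * egfK := by
  ext n
  cases n with
  | zero => simp [egfK₁, K12_zero]
  | succ n =>
    rw [map_add, mul_comm, coeff_mul, Nat.sum_antidiagonal_eq_sum_range_succ_mk,
      sum_range_succ]
    simp only [egfK, egfK₁, coeff_mk, K12_succ_fst, map_sub, coeff_exp, coeff_one,
      Nat.sub_self]
    simp only [Nat.add_eq_zero_iff, one_ne_zero, and_false, if_false, if_true]
    simp only [Nat.factorial_zero, Nat.cast_one, div_one, map_one, sub_self, mul_zero, add_zero,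
      zero_add]
    push_cast
    rw [sum_div]
    refine sum_congr rfl fun j hj => ?_
    have hj' : j < n + 1 := mem_range.mp hj
    rw [if_neg (by omega), Nat.cast_choose ℚ hj'.le]
    simp only [sub_zero]
    field_simp

/-- The exponential generating function of ordered partitions into `s` parts is `(eˣ - 1) ^ s`. -/
theorem coeff_exp_sub_one_pow_mul_factorial (m s : ℕ) :
    coeff m ((exp ℚ - 1) ^ s) * (m.factorial : ℚ) = s.factorial * stirling2 m s := by
  induction m generalizing s with
  | zero => cases s <;> simp [stirling2]
  | succ m ih =>
    cases s with
    | zero => simp [stirling2, coeff_one]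
    | succ s =>
      have hderiv : d⁄dX ℚ ((exp ℚ - 1) ^ (s + 1)) =
          ((s + 1 : ℕ) : ℚ⟦X⟧) * ((exp ℚ - 1) ^ s + (exp ℚ - 1) ^ (s + 1)) := by
        rw [Derivation.leibniz_pow, map_sub, derivative_exp]
        simp only [Derivation.map_one_eq_zero, sub_zero, Nat.add_sub_cancel, smul_eq_mul,
          nsmul_eq_mul]
        ring
      have h := congrArg (coeff m) hderiv
      rw [coeff_derivative, ← map_natCast (C (R := ℚ)), coeff_C_mul, map_add] at h
      rw [Nat.factorial_succ, stirling2]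
      have h₁ := ih s
      have h₂ := ih (s + 1)
      push_cast [Nat.factorial_succ] at h h₁ h₂ ⊢
      linear_combination (m.factorial : ℚ) * h + (s + 1 : ℚ) * (h₁ + h₂)

theorem coeff_one_add_X_pow_mul_exp_sub_one_pow (m s : ℕ) :
    coeff m ((1 + X) ^ (s + 1) * (exp ℚ - 1) ^ s) * (m.factorial : ℚ) =
      ∑ r ∈ range (m + 1), (((s + 1).choose r * m.choose r * r.factorial * s.factorial *
        stirling2 (m - r) s : ℕ) : ℚ) := by
  rw [coeff_mul, Nat.sum_antidiagonal_eq_sum_range_succ_mk, sum_mul]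
  refine sum_congr rfl fun r hr => ?_
  have hr' : r ≤ m := Nat.lt_succ_iff.mp (mem_range.mp hr)
  have hc : coeff r ((1 + X : ℚ⟦X⟧) ^ (s + 1)) = (s + 1).choose r := by
    rw [← Polynomial.coeff_one_add_X_pow, ← Polynomial.coeff_coe]
    simp
  have h := coeff_exp_sub_one_pow_mul_factorial (m - r) s
  have hm : (m.factorial : ℚ) = m.choose r * r.factorial * (m - r).factorial := by
    exact_mod_cast (Nat.choose_mul_factorial_mul_factorial hr').symm
  rw [hc, hm]
  push_cast
  linear_combination ((s + 1).choose r * m.choose r * r.factorial : ℚ) * h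

theorem K12_add_eq_sum (m : ℕ) :
    (K12 m).1 + (K12 m).2 = ∑ s ∈ range (m + 1), ∑ r ∈ range (m + 1),
      (s + 1).choose r * m.choose r * r.factorial * s.factorial * stirling2 (m - r) s := by
  set q : ℚ⟦X⟧ := (1 + X) * (exp ℚ - 1) with hq
  have hT : egfK * (1 - q) = 1 + X := by
    linear_combination egfK_eq + (1 + X) * egfK₁_eq
  have hexpand : egfK = egfK * q ^ (m + 1) +
      ∑ s ∈ range (m + 1), (1 + X) ^ (s + 1) * (exp ℚ - 1) ^ s := by
    have hsum : ∑ s ∈ range (m + 1), (1 + X) ^ (s + 1) * (exp ℚ - 1) ^ s =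
        (1 + X) * ∑ s ∈ range (m + 1), q ^ s := by
      rw [mul_sum]
      refine sum_congr rfl fun s _ => ?_
      rw [hq, mul_pow]
      ring
    rw [hsum, ← hT, mul_assoc, mul_neg_geom_sum]
    ring
  have hdvd : (X : ℚ⟦X⟧) ^ (m + 1) ∣ egfK * q ^ (m + 1) :=
    (pow_dvd_pow_of_dvd (X_dvd_iff.mpr (by simp [hq])) _).mul_left _
  have h := congrArg (fun f => coeff m f * (m.factorial : ℚ)) hexpand
  simp only [map_add, X_pow_dvd_iff.mp hdvd m m.lt_succ_self, zero_add, map_sum, sum_mul,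
    coeff_one_add_X_pow_mul_exp_sub_one_pow] at h
  rw [egfK, coeff_mk, div_mul_cancel₀ _ (by exact_mod_cast m.factorial_ne_zero)] at h
  exact_mod_cast h

theorem sum_range_range_eq_sum_Icc {m : ℕ} (hm : 1 ≤ m) :
    ∑ s ∈ range (m + 1), ∑ r ∈ range (m + 1),
      (s + 1).choose r * m.choose r * r.factorial * s.factorial * stirling2 (m - r) s =
    ∑ n ∈ Icc 1 m, ∑ r ∈ range ((n + 1) / 2 + 1),
      (n - r + 1).choose r * m.choose r * r.factorial * (n - r).factorial *
        stirling2 (m - r) (n - r) := by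
  rw [sum_sigma', sum_sigma']
  refine sum_bij_ne_zero (fun x _ _ => ⟨x.1 + x.2, x.2⟩) ?_ ?_ ?_ ?_
  · rintro ⟨s, r⟩ hx hne
    simp only [mem_sigma, mem_range, mem_Icc] at hx ⊢
    have hchoose : r ≤ s + 1 := by
      by_contra! h
      simp [Nat.choose_eq_zero_of_lt h] at hne
    have hstirling : s ≤ m - r := by
      by_contra! h
      simp [stirling2_eq_zero_of_lt h] at hne
    have hpos : 1 ≤ s + r := by
      by_contra! h
      obtain ⟨rfl, rfl⟩ : s = 0 ∧ r = 0 := by omega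
      obtain ⟨m, rfl⟩ := Nat.exists_eq_add_of_le' hm
      simp [stirling2] at hne
    omega
  · rintro ⟨s, r⟩ _ _ ⟨s', r'⟩ _ _ h
    simp only [Sigma.mk.injEq, heq_eq_eq] at h ⊢
    omega
  · rintro ⟨n, r⟩ hx hne
    simp only [mem_sigma, mem_range, mem_Icc] at hx
    have hr : n - r + r = n := by omega
    refine ⟨⟨n - r, r⟩, ?_, hne, ?_⟩
    · simp only [mem_sigma, mem_range]
      omega
    · simp only [hr]
  · rintro ⟨s, r⟩ _ _
    simp only [Nat.add_sub_cancel]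

/-- For `k ≥ 1`,
`I(k) = 1 + ∑_{m=1}^{k} C(k,m) ∑_{n=1}^{m} ∑_{r=0}^{⌈n/2⌉} C(n−r+1,r) C(m,r) r! (n−r)! S(m−r,n−r)`,
where the leading `1` accounts for the empty ordering and `S` is the Stirling number of
the second kind. -/
theorem stmt9 (k : ℕ) (hk : 1 ≤ k) :
    Ifun k = 1 + ∑ m ∈ Finset.Icc 1 k, Nat.choose k m *
      ∑ n ∈ Finset.Icc 1 m, ∑ r ∈ Finset.range ((n+1)/2 + 1),
        Nat.choose (n - r + 1) r * Nat.choose m r * Nat.factorial r *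
          Nat.factorial (n - r) * stirling2 (m - r) (n - r) := by
  have hIcc : range (k + 1) = insert 0 (Icc 1 k) := by
    ext i
    simp only [mem_range, mem_insert, mem_Icc]
    omega
  rw [Ifun, hIcc, sum_insert (by simp), K12_zero]
  simp only [Nat.choose_zero_right, mul_one, add_zero]
  congr 1
  refine sum_congr rfl fun m hm => ?_
  rw [mul_comm, K12_add_eq_sum, sum_range_range_eq_sum_Icc (mem_Icc.mp hm).1]
end

section
/- In the ring ℚ[[X]] of formal power series, (2 − X − exp X) · Σ_{k≥0} (J(k)/k!)·X^k = 1; that is, 1/(2 − x − e^x) is the exponential generating function of the sequence J. -/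
/-- `J 0 = 1` and `J (i+1) = 2(i+1) J i + ∑_{t=2}^{i+1} C(i+1, t) J (i+1−t)`. -/
def Jfun : ℕ → ℕ
  | 0 => 1
  | (i+1) => 2 * (i+1) * Jfun i +
      (Finset.Icc 2 (i+1)).attach.sum (fun t => Nat.choose (i+1) t.1 * Jfun (i+1 - t.1))
decreasing_by
  · exact Nat.lt_succ_self i
  · have := Finset.mem_Icc.mp t.2; omega

/-- `L(k) = ∑_{i=0}^{k} C(k, i) J i`. -/
def Lfun (k : ℕ) : ℕ :=
  ∑ i ∈ Finset.range (k+1), Nat.choose k i * Jfun i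

theorem Jfun_succ (n : ℕ) :
    Jfun (n + 1) = 2 * (n + 1) * Jfun n +
      ∑ t ∈ Finset.Icc 2 (n + 1), (n + 1).choose t * Jfun (n + 1 - t) := by
  rw [Jfun, Finset.sum_attach (Finset.Icc 2 (n + 1))
    (fun t => (n + 1).choose t * Jfun (n + 1 - t))]

/-- The recurrence for `Jfun` as a full binomial convolution. -/
theorem two_mul_Jfun_succ (n : ℕ) :
    2 * Jfun (n + 1) = (n + 1) * Jfun n +
      ∑ t ∈ Finset.range (n + 2), (n + 1).choose t * Jfun (n + 1 - t) := by
  have hsum : ∑ t ∈ Finset.Icc 2 (n + 1), (n + 1).choose t * Jfun (n + 1 - t) =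
      ∑ t ∈ Finset.range n, (n + 1).choose (t + 2) * Jfun (n + 1 - (t + 2)) := by
    rw [← Finset.Ico_add_one_right_eq_Icc, Finset.sum_Ico_eq_sum_range]
    simp [add_comm _ 2, show n + 1 + 1 - 2 = n by omega]
  have hJ := Jfun_succ n
  rw [hsum] at hJ
  rw [Finset.sum_range_succ', Finset.sum_range_succ']
  simp only [add_assoc, Nat.reduceAdd, zero_add, Nat.choose_one_right, Nat.choose_zero_right,
    Nat.add_sub_cancel, Nat.sub_zero] at hJ ⊢
  linarith

/-- The coefficients of `exp X` times an exponential generating function are given by the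
binomial transform. -/
theorem coeff_exp_mul_mk_div_factorial (f : ℕ → ℚ) (n : ℕ) :
    PowerSeries.coeff n (PowerSeries.exp ℚ * PowerSeries.mk fun k => f k / (k.factorial : ℚ)) =
      (∑ t ∈ Finset.range (n + 1), (n.choose t : ℚ) * f (n - t)) / n.factorial := by
  rw [PowerSeries.coeff_mul, Finset.Nat.sum_antidiagonal_eq_sum_range_succ_mk, Finset.sum_div]
  refine Finset.sum_congr rfl fun t ht => ?_
  rw [Nat.cast_choose ℚ (Finset.mem_range_succ_iff.mp ht)]
  simp only [PowerSeries.coeff_exp, PowerSeries.coeff_mk, map_div₀, map_one, map_natCast]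
  field_simp

/-- In `ℚ⟦X⟧`, `(2 − X − exp X) · ∑_{k≥0} (J(k)/k!) X^k = 1`; that is,
`1/(2 − x − eˣ)` is the exponential generating function of the sequence `J`. -/
theorem stmt11 :
    (2 - PowerSeries.X - PowerSeries.exp ℚ) *
      PowerSeries.mk (fun k => (Jfun k : ℚ) / (Nat.factorial k : ℚ)) = 1 := by
  ext n
  rw [sub_mul, sub_mul, map_sub, map_sub, coeff_exp_mul_mk_div_factorial (fun k => (Jfun k : ℚ)),
    two_mul, map_add]
  cases n with
  | zero => simp [Jfun]
  | succ n =>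
    have hJ : (2 * Jfun (n + 1) : ℚ) = (n + 1) * Jfun n +
        ∑ t ∈ Finset.range (n + 2), ((n + 1).choose t : ℚ) * Jfun (n + 1 - t) := by
      exact_mod_cast two_mul_Jfun_succ n
    rw [PowerSeries.coeff_succ_X_mul, PowerSeries.coeff_one, if_neg n.succ_ne_zero,
      ← sub_eq_iff_eq_add'.mpr hJ]
    simp only [PowerSeries.coeff_mk, Nat.factorial_succ, Nat.cast_mul, Nat.cast_add, Nat.cast_one]
    field_simp
    ring
end

section
/- In the ring ℚ[[X]] of formal power series, (2 − X − exp X) · Σ_{k≥0} (L(k)/k!)·X^k = exp X; that is, e^x/(2 − x − e^x) is the exponential generating function of the sequence L. -/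
open PowerSeries in
/-- Multiplying an exponential generating function by `exp` is the binomial transform. -/
theorem exp_mul_mk_div_factorial (a : ℕ → ℚ) :
    exp ℚ * mk (fun k => a k / (Nat.factorial k : ℚ)) =
      mk (fun k => (∑ i ∈ Finset.range (k + 1), (Nat.choose k i : ℚ) * a i) /
        (Nat.factorial k : ℚ)) := by
  ext n
  rw [mul_comm, coeff_mul, Finset.Nat.sum_antidiagonal_eq_sum_range_succ_mk, coeff_mk,
    Finset.sum_div]
  refine Finset.sum_congr rfl fun i hi => ?_
  rw [Nat.cast_choose ℚ (Finset.mem_range_succ_iff.mp hi)]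
  simp only [coeff_mk, coeff_exp, Algebra.algebraMap_self, RingHom.id_apply]
  have := Nat.factorial_ne_zero n
  field_simp

/-- The recursion for `Jfun`, with the sum completed to a full binomial sum. -/
theorem sum_choose_mul_Jfun_add (n : ℕ) :
    ∑ i ∈ Finset.range (n + 2), Nat.choose (n + 1) i * Jfun i + (n + 1) * Jfun n =
      2 * Jfun (n + 1) := by
  have hrec : Jfun (n + 1) = 2 * (n + 1) * Jfun n +
      ∑ t ∈ Finset.Icc 2 (n + 1), Nat.choose (n + 1) t * Jfun (n + 1 - t) := by
    rw [Jfun, Finset.sum_attach (Finset.Icc 2 (n + 1))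
      (fun t => Nat.choose (n + 1) t * Jfun (n + 1 - t))]
  have hreflect : ∑ i ∈ Finset.range (n + 2), Nat.choose (n + 1) i * Jfun i =
      ∑ t ∈ Finset.range (n + 2), Nat.choose (n + 1) t * Jfun (n + 1 - t) := by
    rw [← Finset.sum_range_reflect]
    refine Finset.sum_congr rfl fun t ht => ?_
    rw [show n + 2 - 1 - t = n + 1 - t by omega,
      Nat.choose_symm (Finset.mem_range_succ_iff.mp ht)]
  have hsplit : ∑ t ∈ Finset.range (n + 2), Nat.choose (n + 1) t * Jfun (n + 1 - t) =
      Jfun (n + 1) + (n + 1) * Jfun n +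
        ∑ t ∈ Finset.Icc 2 (n + 1), Nat.choose (n + 1) t * Jfun (n + 1 - t) := by
    rw [← Finset.sum_range_add_sum_Ico _ (show 2 ≤ n + 2 by omega)]
    simp [Finset.sum_range_succ, ← Finset.Ico_succ_right_eq_Icc]
    rfl
  rw [hreflect, hsplit]
  linarith

open PowerSeries in
/-- The exponential generating function of `Jfun` is `1 / (2 - x - eˣ)`. -/
theorem two_sub_X_sub_exp_mul_mk_Jfun :
    (2 - X - exp ℚ) * mk (fun k => (Jfun k : ℚ) / (Nat.factorial k : ℚ)) = 1 := by
  rw [sub_mul, sub_mul, exp_mul_mk_div_factorial, two_mul]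
  ext n
  cases n with
  | zero => simp [Jfun]
  | succ n =>
    have h : (∑ i ∈ Finset.range (n + 2), (Nat.choose (n + 1) i : ℚ) * Jfun i) +
        (n + 1) * Jfun n = 2 * Jfun (n + 1) := by
      exact_mod_cast sum_choose_mul_Jfun_add n
    rw [← eq_sub_iff_add_eq] at h
    simp only [map_sub, map_add, coeff_mk, coeff_succ_X_mul, coeff_one, h]
    rw [Nat.factorial_succ]
    have := Nat.factorial_ne_zero n
    push_cast
    field_simp
    simp
    ring

/-- In `ℚ⟦X⟧`, `(2 − X − exp X) · ∑_{k≥0} (L(k)/k!) X^k = exp X`; that is,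
`eˣ/(2 − x − eˣ)` is the exponential generating function of the sequence `L`. -/
theorem stmt12 :
    (2 - PowerSeries.X - PowerSeries.exp ℚ) *
      PowerSeries.mk (fun k => (Lfun k : ℚ) / (Nat.factorial k : ℚ)) =
      PowerSeries.exp ℚ := by
  have hL : PowerSeries.mk (fun k => (Lfun k : ℚ) / (Nat.factorial k : ℚ)) =
      PowerSeries.exp ℚ * PowerSeries.mk (fun k => (Jfun k : ℚ) / (Nat.factorial k : ℚ)) := by
    rw [exp_mul_mk_div_factorial]
    simp [Lfun]
  rw [hL, mul_left_comm, two_sub_X_sub_exp_mul_mk_Jfun, mul_one]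
end

section
/- As k → ∞, L(k)·Z^{k+1}/k! converges to (2 − Z)/(3 − Z) (≈ 0.6089389); equivalently, L(k) is asymptotically equivalent to k!·((2 − Z)/(3 − Z))·(1/Z)^{k+1}. -/
open Finset PowerSeries

/-- The defining recurrence of `Jfun`, rewritten in terms of `Lfun`. -/
lemma Lfun_succ_add (n : ℕ) : Lfun (n + 1) + (n + 1) * Jfun n = 2 * Jfun (n + 1) := by
  have hJ : Jfun (n + 1) = 2 * (n + 1) * Jfun n +
      ∑ t ∈ Icc 2 (n + 1), Nat.choose (n + 1) t * Jfun (n + 1 - t) := by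
    rw [Jfun, Finset.sum_attach (Icc 2 (n + 1))
      (fun t => Nat.choose (n + 1) t * Jfun (n + 1 - t))]
  have hL : Lfun (n + 1) =
      ∑ t ∈ range (n + 2), Nat.choose (n + 1) t * Jfun (n + 1 - t) := by
    rw [Lfun, ← Finset.sum_range_reflect]
    refine Finset.sum_congr rfl fun t ht => ?_
    have ht' : t ≤ n + 1 := by simpa [Nat.lt_succ_iff] using ht
    rw [show n + 1 + 1 - 1 - t = n + 1 - t by omega, Nat.choose_symm ht']
  have hS : ∑ t ∈ Icc 2 (n + 1), Nat.choose (n + 1) t * Jfun (n + 1 - t) =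
      ∑ t ∈ range n, Nat.choose (n + 1) (t + 2) * Jfun (n + 1 - (t + 2)) := by
    rw [← Finset.Ico_succ_right_eq_Icc, Finset.sum_Ico_eq_sum_range]
    refine Finset.sum_congr (by simp) fun t _ => by rw [add_comm 2 t]
  rw [Finset.sum_range_succ', Finset.sum_range_succ'] at hL
  simp only [add_assoc, Nat.reduceAdd, ← hS] at hL
  simp at hL
  rw [hL]
  linarith

/-- A solution `D` of `D = 1 + P * D` has absolutely summable coefficients as soon as the
coefficients of `P` have absolute sum less than one. -/
lemma summable_abs_coeff_of_eq_one_add_mul {P D : PowerSeries ℝ} {m : ℝ} (hm : m < 1)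
    (hP : HasSum (fun n => |coeff n P|) m) (hD : D = 1 + P * D) :
    Summable fun n => |coeff n D| := by
  refine summable_of_sum_range_le (c := 1 / (1 - m)) (fun _ => abs_nonneg _) fun N => ?_
  rw [le_div_iff₀ (by linarith)]
  set s := ∑ n ∈ range N, |coeff n D| with hs
  have hs0 : 0 ≤ s := Finset.sum_nonneg fun _ _ => abs_nonneg _
  have hone : ∑ n ∈ range N, |coeff n (1 : PowerSeries ℝ)| ≤ 1 := by
    simp only [coeff_one]
    simp only [apply_ite abs, abs_one, abs_zero, Finset.sum_ite_eq']
    split_ifs <;> norm_num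
  have hcoeff : ∀ n, |coeff n D| ≤ |coeff n (1 : PowerSeries ℝ)| +
      ∑ k ∈ range (n + 1), |coeff k P| * |coeff (n - k) D| := by
    intro n
    conv_lhs => rw [hD]
    rw [map_add, coeff_mul, Finset.Nat.sum_antidiagonal_eq_sum_range_succ_mk]
    refine (abs_add_le _ _).trans (add_le_add le_rfl ?_)
    refine (Finset.abs_sum_le_sum_abs _ _).trans (le_of_eq ?_)
    simp only [abs_mul]
  have hle : s ≤ 1 + m * s := by
    calc s ≤ ∑ n ∈ range N, (|coeff n (1 : PowerSeries ℝ)| +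
            ∑ k ∈ range (n + 1), |coeff k P| * |coeff (n - k) D|) :=
          Finset.sum_le_sum fun n _ => hcoeff n
      _ ≤ 1 + ∑ k ∈ range N, ∑ j ∈ range (N - k), |coeff k P| * |coeff j D| := by
          rw [Finset.sum_add_distrib,
            Finset.sum_range_diag_flip N fun k j => |coeff k P| * |coeff j D|]
          exact add_le_add hone le_rfl
      _ ≤ 1 + ∑ k ∈ range N, |coeff k P| * s := by
          gcongr with k _
          rw [← Finset.mul_sum]
          gcongr
          exact Finset.sum_le_sum_of_subset_of_nonneg
            (Finset.range_subset_range.2 (Nat.sub_le _ _)) fun _ _ _ => abs_nonneg _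
      _ ≤ 1 + m * s := by
          rw [← Finset.sum_mul]
          gcongr
          exact sum_le_hasSum _ (fun _ _ => abs_nonneg _) hP
  linarith

/-- The sum of the coefficients of a product of absolutely summable power series. -/
lemma hasSum_coeff_mul {F G : PowerSeries ℝ} (hF : Summable fun n => |coeff n F|)
    (hG : Summable fun n => |coeff n G|) :
    HasSum (fun n => coeff n (F * G)) ((∑' n, coeff n F) * ∑' n, coeff n G) := by
  have hFG := (summable_norm_sum_mul_antidiagonal_of_summable_norm
    (f := fun n => coeff n F) (g := fun n => coeff n G) hF hG).of_norm.hasSum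
  rw [← tsum_mul_tsum_eq_tsum_sum_antidiagonal_of_summable_norm
    (f := fun n => coeff n F) (g := fun n => coeff n G) hF hG] at hFG
  simpa only [coeff_mul] using hFG

lemma sum_range_coeff_one_sub_X_mul (B : PowerSeries ℝ) (n : ℕ) :
    ∑ k ∈ range (n + 1), coeff k ((1 - X) * B) = coeff n B := by
  induction n with
  | zero => simp [sub_mul]
  | succ n ih => rw [Finset.sum_range_succ, ih, sub_mul, one_mul, map_sub, coeff_succ_X_mul]; ring

lemma hasSum_exp_series (Z : ℝ) : HasSum (fun n : ℕ => Z ^ n / (n.factorial : ℝ)) (Real.exp Z) := by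
  rw [Real.exp_eq_exp_ℝ]
  exact NormedSpace.expSeries_div_hasSum_exp Z

/-- The remainders of the exponential series at `Z` sum to `Z * exp Z`. -/
lemma hasSum_exp_remainder {Z : ℝ} (hZ : 0 ≤ Z) :
    HasSum (fun n : ℕ => Real.exp Z - ∑ t ∈ range (n + 1), Z ^ t / (t.factorial : ℝ))
      (Z * Real.exp Z) := by
  set f : ℕ × ℕ → ℝ := fun x => Z ^ (x.2 + (x.1 + 1)) / ((x.2 + (x.1 + 1)).factorial : ℝ) with hf
  have hdiag : HasSum (fun s : ℕ => ∑ x ∈ antidiagonal s, f x) (Z * Real.exp Z) := by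
    refine ((hasSum_exp_series Z).mul_left Z).congr_fun fun s => ?_
    have : ∀ x ∈ antidiagonal s, f x = Z ^ (s + 1) / ((s + 1).factorial : ℝ) := by
      intro x hx
      rw [HasAntidiagonal.mem_antidiagonal] at hx
      simp only [hf, show x.2 + (x.1 + 1) = s + 1 by omega]
    rw [Finset.sum_congr rfl this, Finset.sum_const, Finset.Nat.card_antidiagonal,
      Nat.factorial_succ, nsmul_eq_mul, pow_succ']
    have := Nat.factorial_pos s
    push_cast
    field_simp
  have hsig : HasSum (fun y : Σ n : ℕ, antidiagonal n => f (y.2 : ℕ × ℕ)) (Z * Real.exp Z) := by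
    have hfiber : ∀ s : ℕ, HasSum (fun y : antidiagonal s => f y) (∑ x ∈ antidiagonal s, f x) :=
      fun s => by
        rw [← Finset.sum_coe_sort]
        exact hasSum_fintype _
    refine HasSum.sigma_of_hasSum hdiag hfiber ?_
    rw [summable_sigma_of_nonneg fun y => by simp only [hf]; positivity]
    refine ⟨fun s => (hfiber s).summable, ?_⟩
    simpa only [(hfiber _).tsum_eq] using hdiag.summable
  have hprod : HasSum f (Z * Real.exp Z) :=
    Finset.HasAntidiagonal.sigmaAntidiagonalEquivProd.hasSum_iff.1 hsig
  refine hprod.prod_fiberwise fun n => ?_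
  exact (hasSum_nat_add_iff' (n + 1)).2 (hasSum_exp_series Z)

/-- Let `Z ∈ (0,1)` be the unique real with `Z + e^Z = 2`. Then
`L(k) · Z^(k+1) / k! → (2 − Z)/(3 − Z)` as `k → ∞`; equivalently, `L(k)` is
asymptotically `k! · ((2 − Z)/(3 − Z)) · (1/Z)^(k+1)`. -/
theorem stmt13 (Z : ℝ) (hZ : Z ∈ Set.Ioo (0 : ℝ) 1) (hZeq : Z + Real.exp Z = 2) :
    Filter.Tendsto
      (fun k : ℕ => (Lfun k : ℝ) * Z ^ (k + 1) / (Nat.factorial k : ℝ))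
      Filter.atTop (nhds ((2 - Z) / (3 - Z))) := by
  obtain ⟨hZ0, hZ1⟩ := hZ
  set r : ℕ → ℝ := fun n => Real.exp Z - ∑ t ∈ range (n + 1), Z ^ t / (t.factorial : ℝ) with hr
  have hrsum : HasSum r (Z * Real.exp Z) := hasSum_exp_remainder hZ0.le
  have hrnonneg : ∀ n, 0 ≤ r n := fun n =>
    sub_nonneg.2 (sum_le_hasSum _ (fun _ _ => by positivity) (hasSum_exp_series Z))
  have hr0 : r 0 = 1 - Z := by simp [hr]; linarith
  set A : PowerSeries ℝ := mk fun n => (Jfun n : ℝ) * Z ^ n / (n.factorial : ℝ) with hA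
  set E : PowerSeries ℝ := mk fun n => Z ^ n / (n.factorial : ℝ) with hE
  set R : PowerSeries ℝ := mk r with hR
  set P : PowerSeries ℝ := C (1 - Z) - R with hP
  set D : PowerSeries ℝ := (1 - X) * A with hD
  have hAE : ∀ n, coeff n (A * E) = (Lfun n : ℝ) * Z ^ n / (n.factorial : ℝ) := by
    intro n
    rw [coeff_mul, Finset.Nat.sum_antidiagonal_eq_sum_range_succ_mk, Lfun]
    push_cast
    rw [Finset.sum_mul, Finset.sum_div]
    refine Finset.sum_congr rfl fun i hi => ?_
    have hi' : i ≤ n := by simpa [Nat.lt_succ_iff] using hi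
    have h1 := Nat.factorial_pos i
    have h2 := Nat.factorial_pos n
    have h3 := Nat.factorial_pos (n - i)
    simp only [hA, hE, coeff_mk]
    rw [Nat.cast_choose ℝ hi', ← pow_mul_pow_sub Z hi']
    field_simp
  have hAeq : A * (2 - C Z * X - E) = 1 := by
    have : A * E = 2 * A - C Z * (X * A) - 1 := by
      ext n
      rw [hAE, show (2 : PowerSeries ℝ) = C 2 from (map_ofNat C 2).symm, map_sub, map_sub,
        coeff_C_mul, coeff_C_mul]
      cases n with
      | zero => simp [hA, Lfun, Jfun]; norm_num
      | succ n =>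
        rw [coeff_succ_X_mul, coeff_one, if_neg (Nat.succ_ne_zero n)]
        simp only [hA, coeff_mk]
        have h := congrArg (Nat.cast : ℕ → ℝ) (Lfun_succ_add n)
        push_cast at h
        rw [eq_sub_of_add_eq h, Nat.factorial_succ]
        have := Nat.factorial_pos n
        push_cast
        field_simp
        ring
    linear_combination -this
  have hReq : (1 - X) * R = C (Real.exp Z) - E := by
    ext n
    rw [sub_mul, one_mul, map_sub, map_sub]
    cases n with
    | zero => simp [hR, hE, hr]
    | succ n =>
      rw [coeff_succ_X_mul, coeff_C, if_neg (Nat.succ_ne_zero n)]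
      simp only [hR, hE, hr, coeff_mk]
      rw [Finset.sum_range_succ _ (n + 1)]
      ring
  have hCZ : C Z + C (Real.exp Z) = (2 : PowerSeries ℝ) := by
    rw [← map_add, hZeq, map_ofNat]
  have hDQ : D * (1 - P) = 1 := by
    rw [hD, hP, map_sub, map_one]
    linear_combination hAeq + A * hReq + A * hCZ
  have hPsum : HasSum (fun n => coeff n P) ((1 - Z) - Z * Real.exp Z) := by
    have hC : HasSum (fun n => coeff n (C (1 - Z) : PowerSeries ℝ)) (1 - Z) := by
      simp only [coeff_C]
      exact hasSum_ite_eq 0 (1 - Z)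
    simpa [hP, hR] using hC.sub hrsum
  have hPabs : HasSum (fun n => |coeff n P|) (Z * Real.exp Z - (1 - Z)) := by
    rw [← neg_sub]
    refine hPsum.neg.congr_fun fun n => abs_of_nonpos ?_
    cases n with
    | zero => simp [hP, hR, hr0]
    | succ n => simpa [hP, hR, coeff_C] using hrnonneg (n + 1)
  have hexp : Real.exp Z = 2 - Z := by linarith
  have hm : Z * Real.exp Z - (1 - Z) < 1 := by rw [hexp]; nlinarith
  have hDabs : Summable fun n => |coeff n D| :=
    summable_abs_coeff_of_eq_one_add_mul hm hPabs (by linear_combination hDQ)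
  have hEsum : HasSum (fun n => coeff n E) (Real.exp Z) := by
    simpa [hE] using hasSum_exp_series Z
  have hEabs : Summable fun n => |coeff n E| := hEsum.summable.abs
  have hDtsum : (∑' n, coeff n D) * (Z * (3 - Z)) = 1 := by
    have h1 := hasSum_coeff_mul hDabs hPabs.summable
    have h2 : HasSum (fun n => coeff n (D * P)) (∑' n, coeff n D - 1) := by
      have hone : HasSum (fun n => coeff n (1 : PowerSeries ℝ)) 1 := by
        simp only [coeff_one]
        exact hasSum_ite_eq 0 (1 : ℝ)
      have := hDabs.of_abs.hasSum.sub hone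
      simp only [← map_sub] at this
      rwa [show D - 1 = D * P by linear_combination hDQ] at this
    have h3 := h1.unique h2
    rw [hPsum.tsum_eq, hexp] at h3
    linear_combination -h3
  have hlim := (hasSum_coeff_mul hDabs hEabs).tendsto_sum_nat.comp (Filter.tendsto_add_atTop_nat 1)
  have hpartial : ∀ k, ∑ i ∈ range (k + 1), coeff i (D * E) =
      (Lfun k : ℝ) * Z ^ k / (k.factorial : ℝ) := by
    intro k
    rw [hD, mul_assoc, sum_range_coeff_one_sub_X_mul, hAE]
  convert hlim.const_mul Z using 2 with k
  · simp only [Function.comp_apply, hpartial, pow_succ]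
    ring
  · rw [hEsum.tsum_eq, hexp, div_eq_iff (by linarith)]
    linear_combination (-(2 - Z)) * hDtsum
end

section
/- For every real number p with 0 < p ≤ 1/2, one has (1/ln 2)^{1−p} · 2^{(1−p)·H(p/(1−p))} ≤ 2.123, where H is the binary entropy function. (The maximum of the left-hand side over this range is approximately 2.12243, attained at p = (−1 + √(1 + 4 ln 2))/(2·√(1 + 4 ln 2)).) -/
/-- The binary entropy function `H(t) = −t·log₂ t − (1−t)·log₂(1−t)`
(with the conventions `H(0) = H(1) = 0`, which hold since `Real.logb 2 0 = 0`). -/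
noncomputable def binEntropy2 (t : ℝ) : ℝ :=
  -(t * Real.logb 2 t) - (1 - t) * Real.logb 2 (1 - t)

/-- The inequality `x * log (u / x) ≤ u - x`, written additively so that it also covers `x = 0`. -/
theorem mul_log_sub_mul_log_le_sub {x u : ℝ} (hx : 0 ≤ x) (hu : 0 < u) :
    x * Real.log u - x * Real.log x ≤ u - x := by
  rcases hx.eq_or_lt with rfl | hx
  · simpa using hu.le
  · have h := mul_le_mul_of_nonneg_left (Real.log_le_sub_one_of_pos (div_pos hu hx)) hx.le
    rw [Real.log_div hu.ne' hx.ne', mul_sub, mul_sub, mul_div_cancel₀ _ hx.ne', mul_one] at h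
    exact h

/-- Gibbs' inequality for two-point distributions. -/
theorem binEntropy2_mul_log_two_le {t u : ℝ} (ht0 : 0 ≤ t) (ht1 : t ≤ 1) (hu0 : 0 < u)
    (hu1 : u < 1) :
    binEntropy2 t * Real.log 2 ≤ -(t * Real.log u) - (1 - t) * Real.log (1 - u) := by
  have hlog : Real.log 2 ≠ 0 := (Real.log_pos one_lt_two).ne'
  have h : binEntropy2 t * Real.log 2 = -(t * Real.log t) - (1 - t) * Real.log (1 - t) := by
    unfold binEntropy2 Real.logb
    field_simp
  linarith [mul_log_sub_mul_log_le_sub ht0 hu0,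
    mul_log_sub_mul_log_le_sub (sub_nonneg.2 ht1) (sub_pos.2 hu1)]

/-- Gibbs' inequality against the distribution `(1 - r, r)` with `r = 1 / (c * M)`, where the
hypothesis `h` says that `c * r ^ 2 ≤ 1 - r`. -/
theorem binEntropy2_mul_log_two_le_affine {t c M : ℝ} (ht0 : 0 ≤ t) (ht1 : t ≤ 1) (hc : 0 < c)
    (hM : 0 < M) (h : M + 1 ≤ c * M ^ 2) :
    binEntropy2 t * Real.log 2 ≤ (1 + t) * Real.log M + Real.log c := by
  have hsub : 1 / (c * M ^ 2) ≤ 1 - 1 / (c * M) := by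
    rw [le_sub_iff_add_le]
    calc 1 / (c * M ^ 2) + 1 / (c * M) = (M + 1) / (c * M ^ 2) := by field_simp; ring
      _ ≤ 1 := (div_le_one (by positivity)).2 h
  have hpos : 0 < 1 / (c * M ^ 2) := by positivity
  have hr : 0 < 1 / (c * M) := by positivity
  have gibbs := binEntropy2_mul_log_two_le ht0 ht1 (hpos.trans_le hsub) (sub_lt_self 1 hr)
  have hlog := mul_le_mul_of_nonneg_left (Real.log_le_log hpos hsub) ht0
  rw [one_div (c * M ^ 2), Real.log_inv, Real.log_mul hc.ne' (by positivity), Real.log_pow] at hlog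
  rw [sub_sub_cancel, one_div (c * M), Real.log_inv, Real.log_mul hc.ne' hM.ne'] at gibbs
  rw [one_div (c * M)] at hlog
  push_cast at hlog
  linarith

/-- For every real `p` with `0 < p ≤ 1/2`,
`(1/ln 2)^(1−p) · 2^((1−p)·H(p/(1−p))) ≤ 2.123`, where `H` is the binary entropy
function. -/
theorem stmt17 (p : ℝ) (hp0 : 0 < p) (hp : p ≤ 1 / 2) :
    (1 / Real.log 2) ^ (1 - p) *
      (2 : ℝ) ^ ((1 - p) * binEntropy2 (p / (1 - p))) ≤ 2.123 := by
  have hc : 0 < Real.log 2 := Real.log_pos one_lt_two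
  have hq : 0 < 1 - p := by linarith
  have hbound := binEntropy2_mul_log_two_le_affine (t := p / (1 - p)) (c := Real.log 2)
    (M := 2.123) (by positivity) ((div_le_one hq).2 (by linarith)) hc (by norm_num)
    (by linarith [Real.log_two_gt_d9])
  have hmul := mul_le_mul_of_nonneg_left hbound hq.le
  have hone : (1 - p) * (1 + p / (1 - p)) = 1 := by
    field_simp
    ring
  rw [mul_add, ← mul_assoc (1 - p) (1 + _), hone] at hmul
  rw [← Real.log_le_log_iff (by positivity) (by norm_num),
    Real.log_mul (by positivity) (by positivity), Real.log_rpow (by positivity),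
    Real.log_rpow two_pos, one_div, Real.log_inv]
  linarith
end

section
/- Let a : ℕ → ℕ be the sequence defined by a(0) = 1 and a(n+1) = Σ_{i=1}^{n+1} C(n+1, i)·a(n+1−i) (the ordered Bell / Fubini numbers, counting linearly ordered partitions of an (n+1)-element set into nonempty blocks). Then a(k)·(ln 2)^{k+1}/k! converges to 1/2 as k → ∞; in particular a(k) = O(k!·(1/ln 2)^k). -/
/-- The ordered Bell (Fubini) numbers: `a 0 = 1` and
`a (n+1) = ∑_{i=1}^{n+1} C(n+1, i) · a (n+1−i)`, counting linearly ordered partitions of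
an `(n+1)`-element set into nonempty blocks. -/
def fubini : ℕ → ℕ
  | 0 => 1
  | (n+1) =>
    (Finset.Icc 1 (n+1)).attach.sum (fun i => Nat.choose (n+1) i.1 * fubini (n+1 - i.1))
decreasing_by
  have := Finset.mem_Icc.mp i.2; omega

open PowerSeries in
/-- If a nonnegative sequence `r` with `r 0 = 1` has total mass less than `2`, then its convolution
inverse is absolutely summable. -/
theorem summable_abs_of_mk_mul_mk_eq_one {r u : ℕ → ℝ} {S : ℝ} (hr : ∀ n, 0 ≤ r n)
    (hr0 : r 0 = 1) (hS : HasSum r S) (hS2 : S < 2) (h : mk r * mk u = 1) :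
    Summable fun n => |u n| := by
  have hcoeff (n : ℕ) :
      ∑ x ∈ Finset.HasAntidiagonal.antidiagonal n, r x.1 * u x.2 = if n = 0 then 1 else 0 := by
    simpa [coeff_mul, coeff_one] using congrArg (coeff n) h
  have hterm (n : ℕ) : 2 * |u n| ≤
      (if n = 0 then 1 else 0) + ∑ x ∈ Finset.HasAntidiagonal.antidiagonal n, r x.1 * |u x.2| := by
    have hmem : ((0, n) : ℕ × ℕ) ∈ Finset.HasAntidiagonal.antidiagonal n := by simp
    have h1 := hcoeff n
    rw [← Finset.add_sum_erase _ _ hmem] at h1 ⊢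
    simp only [hr0, one_mul] at h1 ⊢
    have h2 : |∑ x ∈ (Finset.HasAntidiagonal.antidiagonal n).erase (0, n), r x.1 * u x.2| ≤
        ∑ x ∈ (Finset.HasAntidiagonal.antidiagonal n).erase (0, n), r x.1 * |u x.2| := by
      refine (Finset.abs_sum_le_sum_abs _ _).trans (Finset.sum_le_sum fun x _ => ?_)
      rw [abs_mul, abs_of_nonneg (hr _)]
    have h3 : |u n| ≤ (if n = 0 then 1 else 0) +
        |∑ x ∈ (Finset.HasAntidiagonal.antidiagonal n).erase (0, n), r x.1 * u x.2| := by
      rw [eq_sub_of_add_eq h1]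
      refine (abs_sub _ _).trans (le_of_eq ?_)
      split_ifs <;> simp
    linarith
  have hconv (N : ℕ) :
      ∑ n ∈ Finset.range N, ∑ x ∈ Finset.HasAntidiagonal.antidiagonal n, r x.1 * |u x.2| ≤
      (∑ n ∈ Finset.range N, r n) * ∑ n ∈ Finset.range N, |u n| := by
    rw [Finset.sum_mul_sum, ← Finset.sum_product', ← Finset.sum_biUnion]
    · refine Finset.sum_le_sum_of_subset_of_nonneg (fun x hx => ?_)
        fun x _ _ => mul_nonneg (hr _) (abs_nonneg _)
      simp only [Finset.mem_biUnion, Finset.mem_range,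
        Finset.HasAntidiagonal.mem_antidiagonal, Finset.mem_product] at hx ⊢
      obtain ⟨n, hn, hx⟩ := hx
      omega
    · intro m _ n _ hmn
      refine Finset.disjoint_left.2 fun x hx hx' => hmn ?_
      rw [Finset.HasAntidiagonal.mem_antidiagonal] at hx hx'
      omega
  refine summable_of_sum_range_le (c := 1 / (2 - S)) (fun n => abs_nonneg _) fun N => ?_
  have h1 := Finset.sum_le_sum fun n (_ : n ∈ Finset.range N) => hterm n
  rw [← Finset.mul_sum, Finset.sum_add_distrib] at h1
  have h2 : ∑ n ∈ Finset.range N, (if n = 0 then (1 : ℝ) else 0) ≤ 1 := by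
    rw [Finset.sum_ite_eq']
    split_ifs <;> simp
  have h3 : (∑ n ∈ Finset.range N, r n) * ∑ n ∈ Finset.range N, |u n| ≤
      S * ∑ n ∈ Finset.range N, |u n| :=
    mul_le_mul_of_nonneg_right (sum_le_hasSum _ (fun n _ => hr n) hS)
      (Finset.sum_nonneg fun n _ => abs_nonneg _)
  rw [le_div_iff₀ (by linarith)]
  linarith [hconv N]

open PowerSeries in
/-- Elementary renewal theorem: if `(1 - X) * r` is the convolution inverse of `c`, where `r ≥ 0`,
`r 0 = 1` and `∑ r = S < 2`, then `c n` tends to `1 / S`. -/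
theorem tendsto_of_mk_mul_one_sub_X_mul_mk_eq_one {r c : ℕ → ℝ} {S : ℝ} (hr : ∀ n, 0 ≤ r n)
    (hr0 : r 0 = 1) (hS : HasSum r S) (hS2 : S < 2) (h : mk c * ((1 - X) * mk r) = 1) :
    Filter.Tendsto c Filter.atTop (nhds (1 / S)) := by
  set u : ℕ → ℝ := fun n => coeff n (mk c * (1 - X)) with hu
  have hmk : mk u = mk c * (1 - X) := by ext n; simp [hu]
  have hru : mk r * mk u = 1 := by rw [hmk]; linear_combination h
  have hsu : Summable fun n => |u n| := summable_abs_of_mk_mul_mk_eq_one hr hr0 hS hS2 hru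
  have hsum (n : ℕ) : ∑ k ∈ Finset.range (n + 1), u k = c n := by
    induction n with
    | zero => simp [hu, mul_sub]
    | succ n ih => rw [Finset.sum_range_succ, ih]; simp [hu, mul_sub, coeff_succ_mul_X]
  have hprod : S * ∑' n, u n = 1 := by
    rw [← hS.tsum_eq, tsum_mul_tsum_eq_tsum_sum_antidiagonal_of_summable_norm
      (by simpa using hS.summable.abs) (by simpa using hsu)]
    have hcoeff (n : ℕ) :
        ∑ x ∈ Finset.HasAntidiagonal.antidiagonal n, r x.1 * u x.2 = if n = 0 then 1 else 0 := by
      simpa only [coeff_mul, coeff_mk, coeff_one] using congrArg (coeff n) hru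
    simp [hcoeff]
  have hlim := (hsu.of_abs.hasSum.tendsto_sum_nat).comp (Filter.tendsto_add_atTop_nat 1)
  rw [eq_one_div_of_mul_eq_one_right hprod] at hlim
  exact hlim.congr hsum

/-- The tails of the exponential series of `log 2` have total mass `2 * log 2`. -/
theorem hasSum_two_sub_sum_log_two_pow_div_factorial :
    HasSum (fun n : ℕ => 2 - ∑ i ∈ Finset.range (n + 1), Real.log 2 ^ i / (i.factorial : ℝ))
      (2 * Real.log 2) := by
  have hL0 : 0 ≤ Real.log 2 := Real.log_nonneg one_le_two
  have hL1 : Real.log 2 ≤ 1 := by linarith [Real.log_two_lt_d9]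
  have hexp : Real.exp (Real.log 2) = 2 := Real.exp_log two_pos
  set s : ℕ → ℝ := fun n => ∑ i ∈ Finset.range n, Real.log 2 ^ i / (i.factorial : ℝ) with hs
  have hs_le (n : ℕ) : s n ≤ 2 := hexp ▸ Real.sum_le_exp_of_nonneg hL0 n
  have hpartial (n : ℕ) : ∑ j ∈ Finset.range (n + 1), (2 - s (j + 1)) =
      ((n + 1 : ℕ) : ℝ) * (2 - s (n + 1)) + Real.log 2 * s n := by
    induction n with
    | zero => simp [hs]
    | succ n ih =>
      have h1 : s (n + 2) = s (n + 1) + Real.log 2 ^ (n + 1) / ((n + 1).factorial : ℝ) :=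
        Finset.sum_range_succ _ _
      have h2 : s (n + 1) = s n + Real.log 2 ^ n / (n.factorial : ℝ) :=
        Finset.sum_range_succ _ _
      have h3 : (n.factorial : ℝ) ≠ 0 := by positivity
      rw [Finset.sum_range_succ, ih, h1, h2, Nat.factorial_succ]
      push_cast
      field_simp
      ring
  have hbound (n : ℕ) : (n : ℝ) * (2 - s n) ≤ 2 ^ n / (n.factorial : ℝ) := by
    rcases Nat.eq_zero_or_pos n with rfl | hn
    · simp
    have h1 := (le_abs_self _).trans (Real.exp_bound (abs_le.2 ⟨by linarith, hL1⟩) hn)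
    rw [hexp, abs_of_nonneg hL0] at h1
    have h2 : Real.log 2 ^ n ≤ 1 := pow_le_one₀ hL0 hL1
    have h3 : ((n.succ : ℕ) : ℝ) ≤ 2 ^ n := by exact_mod_cast Nat.lt_two_pow_self
    have hn' : (0 : ℝ) < n := by exact_mod_cast hn
    calc (n : ℝ) * (2 - s n)
        ≤ n * (1 * (n.succ / (n.factorial * n))) := by
          refine mul_le_mul_of_nonneg_left (h1.trans ?_) hn'.le
          exact mul_le_mul_of_nonneg_right h2 (by positivity)
      _ = n.succ / n.factorial := by field_simp
      _ ≤ 2 ^ n / n.factorial := by gcongr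
  have htail : Filter.Tendsto (fun n : ℕ => (n : ℝ) * (2 - s n)) Filter.atTop (nhds 0) :=
    squeeze_zero (fun n => mul_nonneg n.cast_nonneg (sub_nonneg.2 (hs_le n))) hbound
      (FloorSemiring.tendsto_pow_div_factorial_atTop 2)
  have hslim : Filter.Tendsto s Filter.atTop (nhds 2) := by
    have := (NormedSpace.expSeries_div_hasSum_exp (Real.log 2)).tendsto_sum_nat
    rwa [← Real.exp_eq_exp_ℝ, hexp] at this
  rw [hasSum_iff_tendsto_nat_of_nonneg fun n => sub_nonneg.2 (hs_le (n + 1)),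
    ← Filter.tendsto_add_atTop_iff_nat 1]
  have := (htail.comp (Filter.tendsto_add_atTop_nat 1)).add (hslim.const_mul (Real.log 2))
  rw [zero_add, mul_comm] at this
  exact this.congr fun n => (hpartial n).symm

theorem fubini_succ (n : ℕ) :
    fubini (n + 1) = ∑ i ∈ Finset.Icc 1 (n + 1), (n + 1).choose i * fubini (n + 1 - i) := by
  rw [fubini]
  exact Finset.sum_attach _ fun i => (n + 1).choose i * fubini (n + 1 - i)

theorem two_mul_fubini_succ (n : ℕ) :
    2 * fubini (n + 1) =
      ∑ x ∈ Finset.HasAntidiagonal.antidiagonal (n + 1), (n + 1).choose x.1 * fubini x.2 := by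
  rw [Finset.Nat.sum_antidiagonal_eq_sum_range_succ_mk, Finset.range_eq_Ico,
    Finset.sum_eq_sum_Ico_succ_bot (by omega), two_mul]
  have hIco : Finset.Ico 1 (n + 1 + 1) = Finset.Icc 1 (n + 1) := rfl
  simpa [hIco] using fubini_succ n

open PowerSeries in
/-- The exponential generating function of the Fubini numbers, rescaled by `L`, is inverse to
`2 - exp (L * X)`. -/
theorem mk_fubini_mul_two_sub_exp (L : ℝ) :
    mk (fun n => (fubini n : ℝ) * L ^ n / (n.factorial : ℝ)) *
      (2 - mk fun n => L ^ n / (n.factorial : ℝ)) = 1 := by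
  rw [mul_sub, sub_eq_iff_eq_add, mul_comm _ (2 : PowerSeries ℝ),
    mul_comm _ (mk fun n => L ^ n / (n.factorial : ℝ))]
  ext n
  have h2 : (2 : PowerSeries ℝ) = C 2 := (map_ofNat C 2).symm
  rw [h2, coeff_C_mul, map_add, coeff_mul]
  simp only [coeff_mk, coeff_one]
  cases n with
  | zero => norm_num [fubini]
  | succ n =>
    have h := congrArg (Nat.cast : ℕ → ℝ) (two_mul_fubini_succ n)
    push_cast at h
    rw [if_neg n.succ_ne_zero, zero_add, ← mul_div_assoc, ← mul_assoc, h, Finset.sum_mul,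
      Finset.sum_div]
    refine Finset.sum_congr rfl fun x hx => ?_
    rw [← Finset.HasAntidiagonal.mem_antidiagonal.1 hx, Nat.cast_add_choose, pow_add]
    field_simp

/-- `a(k) · (ln 2)^(k+1) / k! → 1/2` as `k → ∞`; in particular
`a(k) = O(k! · (1/ln 2)^k)`. -/
theorem stmt18 :
    Filter.Tendsto
      (fun k : ℕ => (fubini k : ℝ) * Real.log 2 ^ (k + 1) / (Nat.factorial k : ℝ))
      Filter.atTop (nhds (1 / 2)) ∧
    ∃ C : ℝ, 0 < C ∧ ∀ k : ℕ,
      (fubini k : ℝ) ≤ C * (Nat.factorial k : ℝ) * (1 / Real.log 2) ^ k := by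
  have hL : 0 < Real.log 2 := Real.log_pos one_lt_two
  have hlim : Filter.Tendsto
      (fun k : ℕ => (fubini k : ℝ) * Real.log 2 ^ k / (Nat.factorial k : ℝ))
      Filter.atTop (nhds (1 / (2 * Real.log 2))) := by
    refine tendsto_of_mk_mul_one_sub_X_mul_mk_eq_one (fun n => sub_nonneg.2 ?_) (by norm_num)
      hasSum_two_sub_sum_log_two_pow_div_factorial (by linarith [Real.log_two_lt_d9]) ?_
    · simpa [Real.exp_log two_pos] using Real.sum_le_exp_of_nonneg hL.le (n + 1)
    · refine Eq.trans ?_ (mk_fubini_mul_two_sub_exp (Real.log 2))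
      refine congrArg _ ?_
      have h2 : (2 : PowerSeries ℝ) = PowerSeries.C 2 := (map_ofNat PowerSeries.C 2).symm
      ext n
      rw [h2, sub_mul, one_mul]
      cases n with
      | zero => simp
      | succ n =>
        simp only [map_sub, PowerSeries.coeff_mk, PowerSeries.coeff_succ_X_mul,
          PowerSeries.coeff_C, if_neg n.succ_ne_zero]
        rw [Finset.sum_range_succ _ (n + 1)]
        ring
  constructor
  · have h := hlim.mul_const (Real.log 2)
    rw [show 1 / (2 * Real.log 2) * Real.log 2 = 1 / 2 by field_simp] at h
    exact h.congr fun k => by ring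
  · obtain ⟨C, hC⟩ := hlim.bddAbove_range
    refine ⟨max C 1, by positivity, fun k => ?_⟩
    have h := (hC ⟨k, rfl⟩).trans (le_max_left C 1)
    rw [div_le_iff₀ (by positivity), ← le_div_iff₀ (by positivity)] at h
    rwa [one_div, inv_pow, ← div_eq_mul_inv]
end
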